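/- Let K be an algebraically closed field of characteristic zero and R = K[X,Y,Z]. Every homogeneous ideal I ⊆ R that is generated by at most three homogeneous polynomials and satisfies that R/I is Artinian (i.e. I is R_+-primary) has the Weak Lefschetz property. (In the notation of Migliore and Miró-Roig, A(3) ≥ 3.) -/

import Mathlib

open MvPolynomial

/-- The multiplication map `μ_ℓ : A_m → A_{m+1}` on `A = R/I` (with `R = K[X,Y,Z]`)
induced by a linear form `ℓ` is injective, expressed on representatives. -/
def LefInj {K : Type*} [Field K] (I : Ideal (MvPolynomial (Fin 3) K))
    (ℓ : MvPolynomial (Fin 3) K) (m : ℕ) : Prop :=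
  ∀ h : MvPolynomial (Fin 3) K, h.IsHomogeneous m → ℓ * h ∈ I → h ∈ I

/-- The multiplication map `μ_ℓ : A_m → A_{m+1}` on `A = R/I` is surjective,
expressed on representatives. -/
def LefSurj {K : Type*} [Field K] (I : Ideal (MvPolynomial (Fin 3) K))
    (ℓ : MvPolynomial (Fin 3) K) (m : ℕ) : Prop :=
  ∀ g : MvPolynomial (Fin 3) K, g.IsHomogeneous (m + 1) →
    ∃ h : MvPolynomial (Fin 3) K, h.IsHomogeneous m ∧ g - ℓ * h ∈ I

/-- `A = R/I` has the Weak Lefschetz property. -/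
def WeakLefschetz {K : Type*} [Field K] (I : Ideal (MvPolynomial (Fin 3) K)) : Prop :=
  ∃ ℓ : MvPolynomial (Fin 3) K, ℓ ≠ 0 ∧ ℓ.IsHomogeneous 1 ∧
    ∀ m : ℕ, LefInj I ℓ m ∨ LefSurj I ℓ m

section UnivariateVectors
open Polynomial

/-- The vectors `u` of polynomials whose entries satisfy the shifted degree bounds
`deg (u i) + d i < n`. -/
def ShiftedDegLT {E : Type*} [CommRing E] (d : Fin 3 → ℕ) (n : ℕ) (u : Fin 3 → E[X]) : Prop :=
  ∀ i k, n ≤ k + d i → (u i).coeff k = 0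

/-- The polynomials `f i`, with weights `d i`, generate all polynomials of degree `< n`. -/
def GeneratesDegLT {E : Type*} [CommRing E] (d : Fin 3 → ℕ) (f : Fin 3 → E[X]) (n : ℕ) : Prop :=
  ∀ q ∈ degreeLT E n, ∃ h : Fin 3 → E[X], ShiftedDegLT d n h ∧ h ⬝ᵥ f = q

theorem coeff_mul_eq_zero_of_shifted {E : Type*} [CommRing E] {p q : E[X]} {a b n n' : ℕ}
    (hp : ∀ k, n ≤ k + a → p.coeff k = 0) (hq : ∀ k, n' ≤ k + b → q.coeff k = 0)
    (k : ℕ) (hk : n + n' ≤ k + (a + b) + 1) : (p * q).coeff k = 0 := by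
  rw [Polynomial.coeff_mul]
  refine Finset.sum_eq_zero fun x hx => ?_
  rw [Finset.HasAntidiagonal.mem_antidiagonal] at hx
  by_cases h : n ≤ x.1 + a
  · rw [hp _ h, zero_mul]
  · rw [hq _ (by omega), mul_zero]

theorem coeff_eq_zero_of_mul_shifted {E : Type*} [CommRing E] [IsDomain E] {p q : E[X]} {a m : ℕ}
    (hq : q.coeff a ≠ 0) (h : ∀ k, m ≤ k → (p * q).coeff k = 0)
    (k : ℕ) (hk : m ≤ k + a) : p.coeff k = 0 := by
  by_contra hpk
  have h1 := le_natDegree_of_ne_zero hpk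
  have h2 := le_natDegree_of_ne_zero hq
  have hp0 : p ≠ 0 := by rintro rfl; simp at hpk
  have hq0 : q ≠ 0 := by rintro rfl; simp at hq
  have := h (p.natDegree + q.natDegree) (by omega)
  rw [coeff_mul_degree_add_degree] at this
  exact mul_ne_zero (leadingCoeff_ne_zero.2 hp0) (leadingCoeff_ne_zero.2 hq0) this

theorem crossProduct_eq_smul_of_syzygy {E : Type*} [CommRing E] {f r u w : Fin 3 → E}
    (hr : r ⬝ᵥ f = 1) (hu : u ⬝ᵥ f = 0) (hw : w ⬝ᵥ f = 0) :
    crossProduct u w = (r ⬝ᵥ crossProduct u w) • f := by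
  simp only [dotProduct, Fin.sum_univ_three, cross_apply] at *
  ext i
  fin_cases i <;> simp
  · linear_combination (-(u 1 * w 2 - u 2 * w 1)) * hr + (r 1 * w 2 - r 2 * w 1) * hu -
      (r 1 * u 2 - r 2 * u 1) * hw
  · linear_combination (-(u 2 * w 0 - u 0 * w 2)) * hr + (r 2 * w 0 - r 0 * w 2) * hu -
      (r 2 * u 0 - r 0 * u 2) * hw
  · linear_combination (-(u 0 * w 1 - u 1 * w 0)) * hr + (r 0 * w 1 - r 1 * w 0) * hu -
      (r 0 * u 1 - r 1 * u 0) * hw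

theorem crossProduct_eq_zero_iff_mul {E : Type*} [CommRing E] {u w : Fin 3 → E} :
    crossProduct u w = 0 ↔ ∀ i k, u i * w k = u k * w i := by
  rw [cross_apply]
  constructor
  · intro h
    have h0 := congrFun h 0
    have h1 := congrFun h 1
    have h2 := congrFun h 2
    simp at h0 h1 h2
    intro i k
    fin_cases i <;> fin_cases k <;> simp <;> grind
  · intro h
    ext i
    fin_cases i <;> simp [h]

theorem eq_smul_of_crossProduct_eq_zero {E : Type*} [CommRing E] {q u w : Fin 3 → E}
    (hq : q ⬝ᵥ u = 1) (h : crossProduct u w = 0) : w = (q ⬝ᵥ w) • u := by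
  rw [crossProduct_eq_zero_iff_mul] at h
  ext i
  simp only [dotProduct, Fin.sum_univ_three] at *
  simp
  linear_combination (-w i) * hq + q 0 * h 0 i + q 1 * h 1 i + q 2 * h 2 i

theorem crossProduct_coeff_eq_zero {E : Type*} [CommRing E] {d : Fin 3 → ℕ} {m n : ℕ}
    {u w : Fin 3 → E[X]} (hu : ShiftedDegLT d m u) (hw : ShiftedDegLT d n w) (i : Fin 3) (k : ℕ)
    (hk : m + n + d i ≤ k + (d 0 + d 1 + d 2) + 1) : (crossProduct u w i).coeff k = 0 := by
  have key : ∀ a b, a ≠ i → b ≠ i → a ≠ b → (u a * w b).coeff k = 0 := fun a b ha hb hab =>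
    coeff_mul_eq_zero_of_shifted (hu a) (hw b) k (by
      have : d a + d b + d i = d 0 + d 1 + d 2 := by
        fin_cases a <;> fin_cases b <;> fin_cases i <;> simp at * <;> omega
      omega)
  rw [cross_apply]
  fin_cases i <;> simp [key]

/-- Removing the common factor of a nonzero vector over a principal ideal domain. -/
theorem exists_smul_unimodular {E : Type*} [CommRing E] [IsDomain E] [IsPrincipalIdealRing E]
    {u : Fin 3 → E} (hu : u ≠ 0) :
    ∃ (e : E) (v q : Fin 3 → E), e ≠ 0 ∧ u = e • v ∧ q ⬝ᵥ v = 1 := by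
  obtain ⟨e, he⟩ := (IsPrincipalIdealRing.principal (Ideal.span (Set.range u))).principal
  have h1 : ∀ i, ∃ c, u i = e * c := fun i => by
    have : u i ∈ Ideal.span (Set.range u) := Ideal.subset_span ⟨i, rfl⟩
    rw [he] at this
    exact Ideal.mem_span_singleton.1 this
  choose v hv using h1
  have h2 : e ∈ Ideal.span (Set.range u) := by
    rw [he]; exact Ideal.mem_span_singleton_self e
  obtain ⟨q, hq⟩ := Ideal.mem_span_range_iff_exists_fun.1 h2
  have he0 : e ≠ 0 := by
    rintro rfl
    exact hu (funext fun i => by simp [hv i])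
  refine ⟨e, v, q, he0, funext fun i => by simp [hv i], mul_left_cancel₀ he0 ?_⟩
  rw [mul_one, ← hq.trans (rfl : e = e), dotProduct, Finset.mul_sum]
  rw [hq]
  conv_rhs => rw [← hq]
  exact Finset.sum_congr rfl fun i _ => by rw [hv i]; ring

/-- The exact shifted degree of a nonzero vector. -/
theorem exists_shiftedDeg_eq {E : Type*} [CommRing E] {d : Fin 3 → ℕ} {n : ℕ}
    {u : Fin 3 → E[X]} (hu : u ≠ 0) (hn : ShiftedDegLT d (n + 1) u) :
    ∃ a ≤ n, ShiftedDegLT d (a + 1) u ∧ ∃ i k, k + d i = a ∧ (u i).coeff k ≠ 0 := by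
  classical
  have hex : ∃ m, ShiftedDegLT d m u := ⟨_, hn⟩
  have h0 : ¬ ShiftedDegLT d 0 u := fun h =>
    hu (funext fun i => Polynomial.ext fun k => by simpa using h i k (Nat.zero_le _))
  obtain ⟨a, ha⟩ : ∃ a, Nat.find hex = a + 1 :=
    Nat.exists_eq_succ_of_ne_zero fun h => h0 (h ▸ Nat.find_spec hex)
  have hspec : ShiftedDegLT d (a + 1) u := ha ▸ Nat.find_spec hex
  have hmin : ¬ ShiftedDegLT d a u := Nat.find_min hex (by omega)
  have hle : a + 1 ≤ n + 1 := ha ▸ Nat.find_min' hex hn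
  unfold ShiftedDegLT at hmin
  push Not at hmin
  obtain ⟨i, k, h1, h2⟩ := hmin
  refine ⟨a, by omega, hspec, i, k, ?_, h2⟩
  by_contra h3
  exact h2 (hspec i k (by omega))

theorem ShiftedDegLT.of_smul {E : Type*} [CommRing E] [IsDomain E] {d : Fin 3 → ℕ} {n : ℕ}
    {e : E[X]} {u : Fin 3 → E[X]} (he : e ≠ 0) (h : ShiftedDegLT d n (e • u)) :
    ShiftedDegLT d n u := fun i k hk => by
  have hd : e.coeff e.natDegree ≠ 0 := leadingCoeff_ne_zero.2 he
  refine coeff_eq_zero_of_mul_shifted (q := e) (m := k + e.natDegree) hd (fun k' hk' => ?_) k le_rfl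
  rw [mul_comm]
  exact h i k' (by omega)

theorem finrank_degreeLT {F : Type*} [Field F] (n : ℕ) : Module.finrank F (degreeLT F n) = n := by
  rw [(degreeLTEquiv F n).finrank_eq, Module.finrank_fin_fun]

theorem finrank_map_add_finrank_inf_ker {F V W : Type*} [Field F] [AddCommGroup V] [Module F V]
    [Module.Finite F V] [AddCommGroup W] [Module F W] (φ : V →ₗ[F] W) (S : Submodule F V) :
    Module.finrank F (S.map φ) + Module.finrank F (S ⊓ LinearMap.ker φ : Submodule F V) =
      Module.finrank F S := by
  have h := LinearMap.finrank_range_add_finrank_ker (φ.domRestrict S)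
  rw [LinearMap.range_domRestrict, LinearMap.ker_domRestrict] at h
  rw [← h, ← Submodule.map_comap_subtype,
    (Submodule.equivMapOfInjective _ S.injective_subtype _).finrank_eq]

/-- A dimension count: a linear map onto its target is detected by bounding its kernel through
two further linear maps. -/
theorem map_eq_of_finrank_le {F V W : Type*} [Field F] [AddCommGroup V] [Module F V]
    [Module.Finite F V] [AddCommGroup W] [Module F W] (φ α ρ : V →ₗ[F] W) {P P₁ P₂ : Submodule F W}
    [Module.Finite F P] [Module.Finite F P₁] [Module.Finite F P₂] (hφ : ∀ w, φ w ∈ P)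
    (hα : ∀ w, φ w = 0 → α w ∈ P₁) (hρ : ∀ w, φ w = 0 → α w = 0 → ρ w ∈ P₂)
    (hinj : ∀ w, φ w = 0 → α w = 0 → ρ w = 0 → w = 0)
    (hdim : Module.finrank F P + Module.finrank F P₁ + Module.finrank F P₂ ≤ Module.finrank F V) :
    (⊤ : Submodule F V).map φ = P := by
  have e1 := finrank_map_add_finrank_inf_ker φ ⊤
  have e2 := finrank_map_add_finrank_inf_ker α (⊤ ⊓ LinearMap.ker φ)
  have e3 := finrank_map_add_finrank_inf_ker ρ (⊤ ⊓ LinearMap.ker φ ⊓ LinearMap.ker α)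
  have e4 : (⊤ ⊓ LinearMap.ker φ ⊓ LinearMap.ker α ⊓ LinearMap.ker ρ : Submodule F V) = ⊥ := by
    rw [eq_bot_iff]
    rintro w ⟨⟨⟨-, h1⟩, h2⟩, h3⟩
    exact hinj w h1 h2 h3
  have i2 : (⊤ ⊓ LinearMap.ker φ).map α ≤ P₁ := by
    rintro _ ⟨w, ⟨-, h1⟩, rfl⟩
    exact hα w h1
  have i3 : (⊤ ⊓ LinearMap.ker φ ⊓ LinearMap.ker α).map ρ ≤ P₂ := by
    rintro _ ⟨w, ⟨⟨-, h1⟩, h2⟩, rfl⟩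
    exact hρ w h1 h2
  have i1 : (⊤ : Submodule F V).map φ ≤ P := by
    rintro _ ⟨w, -, rfl⟩
    exact hφ w
  rw [e4, finrank_bot] at e3
  rw [finrank_top] at e1
  have j2 := Submodule.finrank_mono i2
  have j3 := Submodule.finrank_mono i3
  exact Submodule.eq_of_le_of_finrank_le i1 (by omega)

/-- If two syzygies of shifted degree at most `n` of three coprime binary forms (written in an
affine coordinate) are independent, then the forms generate everything in degree `n - 1`. -/
theorem crossProduct_syzygies_eq_zero {F : Type*} [Field F] {f : Fin 3 → F[X]} {d : Fin 3 → ℕ}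
    {r : Fin 3 → F[X]} (hr : r ⬝ᵥ f = 1) (hdeg : ∀ i, (f i).natDegree ≤ d i)
    (htop : ∃ i, (f i).coeff (d i) ≠ 0) {n : ℕ} (hn : ¬ GeneratesDegLT d f n)
    {u v : Fin 3 → F[X]} (hu : ShiftedDegLT d (n + 1) u) (hv : ShiftedDegLT d (n + 1) v)
    (huf : u ⬝ᵥ f = 0) (hvf : v ⬝ᵥ f = 0) : crossProduct u v = 0 := by
  by_contra huv
  apply hn
  have hu0 : u ≠ 0 := by rintro rfl; simp at huv
  obtain ⟨e, u₀, q, he, rfl, hq⟩ := exists_smul_unimodular hu0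
  have hu₀0 : u₀ ≠ 0 := by rintro rfl; simp at hu0
  have hu₀v : crossProduct u₀ v ≠ 0 := by intro h; simp [h] at huv
  have hu₀f : u₀ ⬝ᵥ f = 0 := by
    rw [smul_dotProduct, smul_eq_mul] at huf
    exact (mul_eq_zero.1 huf).resolve_left he
  obtain ⟨a, han, ha, i₁, k₁, hk₁, hlead⟩ := exists_shiftedDeg_eq hu₀0 (hu.of_smul he)
  obtain ⟨i₀, hi₀⟩ := htop
  have hα : ∀ m w, ShiftedDegLT d m w → w ⬝ᵥ f = 0 → ∀ k, a + 1 + m ≤ k + (d 0 + d 1 + d 2) + 1 →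
      (r ⬝ᵥ crossProduct u₀ w).coeff k = 0 := fun m w hw hwf k hk => by
    refine coeff_eq_zero_of_mul_shifted hi₀ (m := k + d i₀) (fun k' hk' => ?_) k le_rfl
    have := congrFun (crossProduct_eq_smul_of_syzygy hr hu₀f hwf) i₀
    simp only [Pi.smul_apply, smul_eq_mul] at this
    rw [← this]
    exact crossProduct_coeff_eq_zero ha hw i₀ k' (by omega)
  have hbig : d 0 + d 1 + d 2 ≤ a + n := by
    by_contra hlt
    apply hu₀v
    rw [crossProduct_eq_smul_of_syzygy hr hu₀f hvf]
    have : r ⬝ᵥ crossProduct u₀ v = 0 :=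
      Polynomial.ext fun k => by simpa using hα _ v hv hvf k (by omega)
    rw [this, zero_smul]
  let ι : ((i : Fin 3) → degreeLT F (n - d i)) →ₗ[F] (Fin 3 → F[X]) :=
    LinearMap.pi fun i => (degreeLT F (n - d i)).subtype ∘ₗ LinearMap.proj i
  have hι : ∀ w, ShiftedDegLT d n (ι w) := fun w i k hk => by
    have := (w i).2
    rw [mem_degreeLT, degree_lt_iff_coeff_zero] at this
    exact this k (by omega)
  let Φ : ((i : Fin 3) → degreeLT F (n - d i)) →ₗ[F] F[X] :=
    ((dotProductBilin F[X] F[X]).flip f).restrictScalars F ∘ₗ ι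
  have hΦ : ∀ w, Φ w = ι w ⬝ᵥ f := fun w => rfl
  have hΦd : ∀ w, Φ w ∈ degreeLT F n := fun w => by
    rw [mem_degreeLT, degree_lt_iff_coeff_zero]
    intro k hk
    rw [hΦ, dotProduct, finsetSum_coeff]
    refine Finset.sum_eq_zero fun i _ => ?_
    have h2 : ∀ k, d i + 1 ≤ k + 0 → (f i).coeff k = 0 := fun k hk =>
      coeff_eq_zero_of_natDegree_lt (by have := hdeg i; omega)
    exact coeff_mul_eq_zero_of_shifted (hι w i) h2 k (by omega)
  let α : ((i : Fin 3) → degreeLT F (n - d i)) →ₗ[F] F[X] :=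
    (dotProductBilin F[X] F[X] r).restrictScalars F ∘ₗ (crossProduct u₀).restrictScalars F ∘ₗ ι
  let ρ : ((i : Fin 3) → degreeLT F (n - d i)) →ₗ[F] F[X] :=
    (dotProductBilin F[X] F[X] q).restrictScalars F ∘ₗ ι
  have hαker : ∀ w, Φ w = 0 → α w = 0 → ι w = (q ⬝ᵥ ι w) • u₀ := fun w hw hw' => by
    apply eq_smul_of_crossProduct_eq_zero hq
    have h2 : r ⬝ᵥ crossProduct u₀ (ι w) = 0 := hw'
    rw [crossProduct_eq_smul_of_syzygy (w := ι w) hr hu₀f hw, h2, zero_smul]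
  have : ∀ m, Module.Finite F (degreeLT F m) := fun m =>
    Module.Finite.equiv (degreeLTEquiv F m).symm
  have hmap := map_eq_of_finrank_le Φ α ρ (P := degreeLT F n)
    (P₁ := degreeLT F (a + n - (d 0 + d 1 + d 2))) (P₂ := degreeLT F (n - a)) hΦd
    (fun w hw => by
      rw [mem_degreeLT, degree_lt_iff_coeff_zero]
      exact fun k hk => hα n (ι w) (hι w) hw k (by omega))
    (fun w hw hw' => by
      rw [mem_degreeLT, degree_lt_iff_coeff_zero]
      intro k hk
      refine coeff_eq_zero_of_mul_shifted hlead (m := k + k₁) (fun k' hk' => ?_) k le_rfl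
      have h3 : (q ⬝ᵥ ι w) * u₀ i₁ = ι w i₁ := (congrFun (hαker w hw hw') i₁).symm
      have h4 := hι w i₁ k' (by omega)
      rw [← h3] at h4
      exact h4)
    (fun w hw hw' hw'' => by
      have h3 := hαker w hw hw'
      have h2 : q ⬝ᵥ ι w = 0 := hw''
      rw [h2, zero_smul] at h3
      exact funext fun i => Subtype.ext (congrFun h3 i))
    (by
      rw [Module.finrank_pi_fintype]
      simp only [finrank_degreeLT]
      rw [Fin.sum_univ_three]
      omega)
  intro p hp
  rw [← hmap] at hp
  obtain ⟨w, -, hw⟩ := hp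
  exact ⟨ι w, hι w, hw⟩

end UnivariateVectors

section LineRestriction
open scoped Polynomial

theorem homogeneousComponent_mul {σ K : Type*} [CommRing K] {p : MvPolynomial σ K} {a : ℕ}
    (hp : p.IsHomogeneous a) (q : MvPolynomial σ K) (m : ℕ) :
    homogeneousComponent m (p * q) = ∑ i ∈ Finset.range (q.totalDegree + 1),
      if m = a + i then p * homogeneousComponent i q else 0 := by
  conv_lhs => rw [← sum_homogeneousComponent q, Finset.mul_sum, map_sum]
  refine Finset.sum_congr rfl fun i _ => ?_
  exact homogeneousComponent_of_mem (hp.mul (homogeneousComponent_isHomogeneous i q))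

theorem homogeneousComponent_mul_left {σ K : Type*} [CommRing K] {p q : MvPolynomial σ K} {a : ℕ}
    (hp : p.IsHomogeneous a) (n : ℕ) :
    homogeneousComponent (a + n) (p * q) = p * homogeneousComponent n q := by
  rw [homogeneousComponent_mul hp]
  simp only [add_right_inj, Finset.sum_ite_eq, Finset.mem_range, ite_eq_left_iff]
  intro h
  rw [homogeneousComponent_eq_zero _ _ (by omega), mul_zero]

theorem homogeneousComponent_mul_left_of_lt {σ K : Type*} [CommRing K] {p q : MvPolynomial σ K}
    {a n : ℕ} (hp : p.IsHomogeneous a) (hn : n < a) : homogeneousComponent n (p * q) = 0 := by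
  rw [homogeneousComponent_mul hp]
  exact Finset.sum_eq_zero fun i _ => if_neg (by omega)

/-- Dehomogenization `Y = 1`, with values in `K[x][z]`. -/
noncomputable def dehom (K : Type*) [CommRing K] : MvPolynomial (Fin 3) K →ₐ[K] K[X][X] :=
  aeval ![Polynomial.C Polynomial.X, 1, Polynomial.X]

/-- Restriction to the affine line `Y = 1`, `Z = σ X + τ`. -/
noncomputable def lineRestrict (K : Type*) [CommRing K] {E : Type*} [CommRing E] [Algebra K E]
    (σ τ : E) : MvPolynomial (Fin 3) K →ₐ[K] E[X] :=
  aeval ![Polynomial.X, 1, Polynomial.C σ * Polynomial.X + Polynomial.C τ]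

theorem dehom_monomial {K : Type*} [CommRing K] (e : Fin 3 →₀ ℕ) (r : K) :
    dehom K (monomial e r) = Polynomial.monomial (e 2) (Polynomial.monomial (e 0) r) := by
  rw [dehom, aeval_monomial, Finsupp.prod_fintype _ _ (by simp)]
  simp [Fin.prod_univ_three, ← Polynomial.C_mul_X_pow_eq_monomial, Polynomial.algebraMap_apply,
    mul_assoc]

theorem lineRestrict_monomial {K : Type*} [CommRing K] {E : Type*} [CommRing E] [Algebra K E]
    (σ τ : E) (e : Fin 3 →₀ ℕ) (r : K) :
    lineRestrict K σ τ (monomial e r) = Polynomial.C (algebraMap K E r) *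
      (Polynomial.X ^ e 0 * (Polynomial.C σ * Polynomial.X + Polynomial.C τ) ^ e 2) := by
  rw [lineRestrict, aeval_monomial, Finsupp.prod_fintype _ _ (by simp)]
  simp [Fin.prod_univ_three, Polynomial.algebraMap_apply]

theorem MvPolynomial.IsHomogeneous.apply_add {K : Type*} [CommRing K]
    {q : MvPolynomial (Fin 3) K} {n : ℕ}
    (hq : q.IsHomogeneous n) {e : Fin 3 →₀ ℕ} (he : e ∈ q.support) : e 0 + e 1 + e 2 = n := by
  have := hq.degree_eq_sum_deg_support he
  rw [Finset.sum_subset (Finset.subset_univ _) (by simp), Fin.sum_univ_three] at this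
  exact this.symm

theorem dehom_injective_of_isHomogeneous {K : Type*} [CommRing K] {q : MvPolynomial (Fin 3) K}
    {n : ℕ} (hq : q.IsHomogeneous n) (h : dehom K q = 0) : q = 0 := by
  by_contra hq0
  obtain ⟨e, he⟩ := support_nonempty.2 hq0
  have h1 : ((dehom K q).coeff (e 2)).coeff (e 0) = q.coeff e := by
    conv_lhs => rw [q.as_sum]
    rw [map_sum, Polynomial.finsetSum_coeff, Polynomial.finsetSum_coeff,
      Finset.sum_eq_single_of_mem e he]
    · simp [dehom_monomial]
    · intro e' he' hne
      rw [dehom_monomial, Polynomial.coeff_monomial]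
      split_ifs with h2
      · rw [Polynomial.coeff_monomial, if_neg]
        intro h0
        apply hne
        have a1 := hq.apply_add he
        have a2 := hq.apply_add he'
        ext i
        fin_cases i
        · exact h0
        · change e' 1 = e 1
          omega
        · exact h2
      · simp
  rw [h] at h1
  exact (MvPolynomial.mem_support_iff.1 he) h1.symm

theorem natDegree_linear_pow_le {E : Type*} [CommRing E] (σ τ : E) (c : ℕ) :
    ((Polynomial.C σ * Polynomial.X + Polynomial.C τ) ^ c).natDegree ≤ c := by
  have := Polynomial.natDegree_pow_le_of_le c (Polynomial.natDegree_linear_le (a := σ) (b := τ))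
  omega

theorem lineRestrict_natDegree_le {K : Type*} [CommRing K] {E : Type*} [CommRing E] [Algebra K E]
    (σ τ : E) {q : MvPolynomial (Fin 3) K} {n : ℕ} (hq : q.IsHomogeneous n) :
    (lineRestrict K σ τ q).natDegree ≤ n := by
  rw [q.as_sum, map_sum]
  refine Polynomial.natDegree_sum_le_of_forall_le _ _ fun e he => ?_
  rw [lineRestrict_monomial]
  have h1 := hq.apply_add he
  have h2 := natDegree_linear_pow_le σ τ (e 2)
  have h3 := Polynomial.natDegree_X_pow_le (R := E) (e 0)
  refine (Polynomial.natDegree_C_mul_le _ _).trans (Polynomial.natDegree_mul_le.trans ?_)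
  omega

theorem lineRestrict_coeff_top {K : Type*} [CommRing K] {E : Type*} [CommRing E] [Algebra K E]
    (σ τ : E) {q : MvPolynomial (Fin 3) K} {n : ℕ} (hq : q.IsHomogeneous n) :
    (lineRestrict K σ τ q).coeff n = aeval ![1, 0, σ] q := by
  conv_lhs => rw [q.as_sum]
  conv_rhs => rw [q.as_sum]
  rw [map_sum, map_sum, Polynomial.finsetSum_coeff]
  refine Finset.sum_congr rfl fun e he => ?_
  have h1 := hq.apply_add he
  rw [lineRestrict_monomial, aeval_monomial, Finsupp.prod_fintype _ _ (by simp),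
    Polynomial.coeff_C_mul, Polynomial.coeff_X_pow_mul', if_pos (by omega)]
  simp only [Fin.prod_univ_three, Matrix.cons_val_zero, Matrix.cons_val_one, one_pow, one_mul]
  congr 1
  change _ = 0 ^ e 1 * σ ^ e 2
  by_cases h0 : e 1 = 0
  · rw [h0, pow_zero, one_mul]
    have := Polynomial.coeff_pow_of_natDegree_le (m := e 2)
      (Polynomial.natDegree_linear_le (a := σ) (b := τ))
    rw [show n - e 0 = e 2 * 1 by omega, this]
    simp
  · rw [zero_pow h0, zero_mul]
    refine Polynomial.coeff_eq_zero_of_natDegree_lt ?_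
    have h2 := natDegree_linear_pow_le σ τ (e 2)
    omega

/-- A form in `X, Y` with prescribed dehomogenization. -/
theorem exists_homogenization_univariate {K : Type*} [CommRing K] (r : K[X]) {n : ℕ}
    (hr : r.natDegree ≤ n) : ∃ q : MvPolynomial (Fin 3) K, q.IsHomogeneous n ∧
      ∀ σ τ : K, lineRestrict K σ τ q = r := by
  refine ⟨∑ k ∈ Finset.range (n + 1), C (r.coeff k) * (X 0 ^ k * X 1 ^ (n - k)),
    IsHomogeneous.sum _ _ _ fun k hk => ?_, fun σ τ => ?_⟩
  · have hk' := Finset.mem_range.1 hk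
    have := ((isHomogeneous_X_pow (R := K) (0 : Fin 3) k).mul
      (isHomogeneous_X_pow (R := K) (1 : Fin 3) (n - k))).C_mul (r.coeff k)
    rwa [show k + (n - k) = n by omega] at this
  · conv_rhs => rw [r.as_sum_range_C_mul_X_pow' (n := n + 1) (by omega)]
    simp [lineRestrict, Polynomial.algebraMap_eq]

/-- A form vanishing on the line `Z = σ X + τ Y` is divisible by the equation of this line. -/
theorem dvd_of_lineRestrict_eq_zero {K : Type*} [CommRing K] (σ τ : K)
    {q : MvPolynomial (Fin 3) K} {n : ℕ} (hq : q.IsHomogeneous n)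
    (h : lineRestrict K σ τ q = 0) : X 2 - C σ * X 0 - C τ * X 1 ∣ q := by
  let ψ : MvPolynomial (Fin 3) K →ₐ[K] MvPolynomial (Fin 3) K :=
    aeval ![X 0, X 1, C σ * X 0 + C τ * X 1]
  have h1 : (ψ q).IsHomogeneous (1 * n) := by
    refine hq.aeval ![X 0, X 1, C σ * X 0 + C τ * X 1] fun i => ?_
    fin_cases i
    · exact isHomogeneous_X _ _
    · exact isHomogeneous_X _ _
    · exact (isHomogeneous_C_mul_X _ _).add (isHomogeneous_C_mul_X _ _)
  let κ : K[X] →ₐ[K] K[X][X] := Polynomial.CAlgHom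
  have hκ : ∀ c, κ c = Polynomial.C c := fun c => rfl
  have h2 : κ.comp (lineRestrict K σ τ) =
      (dehom K).comp ψ := by
    ext i : 1
    fin_cases i <;> simp [dehom, lineRestrict, ψ, hκ, Polynomial.algebraMap_apply]
  have h3 : ψ q = 0 := by
    refine dehom_injective_of_isHomogeneous h1 ?_
    have := DFunLike.congr_fun h2 q
    simp only [AlgHom.comp_apply, h, map_zero] at this
    exact this.symm
  have h4 : (Ideal.Quotient.mkₐ K (Ideal.span {X 2 - C σ * X 0 - C τ * X 1})).comp ψ =
      Ideal.Quotient.mkₐ K (Ideal.span {X 2 - C σ * X 0 - C τ * X 1}) := by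
    ext i : 1
    fin_cases i
    · simp [ψ]
    · simp [ψ]
    · simp only [AlgHom.comp_apply, Ideal.Quotient.mkₐ_eq_mk]
      rw [Ideal.Quotient.mk_eq_mk_iff_sub_mem, ← neg_mem_iff, Ideal.mem_span_singleton]
      simp [ψ, sub_add_eq_sub_sub]
  have h5 := DFunLike.congr_fun h4 q
  rw [AlgHom.comp_apply, h3, map_zero] at h5
  exact Ideal.mem_span_singleton.1 (Ideal.Quotient.eq_zero_iff_mem.1 h5.symm)

/-- A form whose restriction to the line at infinity vanishes is divisible by `Y`. -/
theorem X_one_dvd_of_aeval_eq_zero {K : Type*} [CommRing K] {E : Type*} [CommRing E]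
    [Algebra K E] {σ : E} (hσ : Transcendental K σ) {q : MvPolynomial (Fin 3) K} {n : ℕ}
    (hq : q.IsHomogeneous n) (h : aeval ![1, 0, σ] q = 0) : X 1 ∣ q := by
  have h1 : (Polynomial.aeval σ).comp (aeval ![1, 0, Polynomial.X]) =
      (aeval ![1, 0, σ] : MvPolynomial (Fin 3) K →ₐ[K] E) := by
    ext i
    fin_cases i <;> simp
  rw [← h1, AlgHom.comp_apply] at h
  have h2 : (aeval ![1, 0, Polynomial.X] q : K[X]) = 0 := by
    by_contra hne
    exact hσ ⟨_, hne, h⟩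
  rw [q.as_sum]
  refine Finset.dvd_sum fun e he => X_dvd_monomial.2 (Or.inr fun h0 => ?_)
  have h3 : (aeval ![1, 0, Polynomial.X] q : K[X]).coeff (e 2) = q.coeff e := by
    conv_lhs => rw [q.as_sum]
    rw [map_sum, Polynomial.finsetSum_coeff, Finset.sum_eq_single_of_mem e he]
    · rw [aeval_monomial, Finsupp.prod_fintype _ _ (by simp)]
      simp [Fin.prod_univ_three, h0, Polynomial.algebraMap_eq]
    · intro e' he' hne
      rw [aeval_monomial, Finsupp.prod_fintype _ _ (by simp)]
      simp only [Fin.prod_univ_three, Matrix.cons_val_zero, Matrix.cons_val_one, one_pow, one_mul]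
      change (_ * (0 ^ e' 1 * Polynomial.X ^ e' 2)).coeff _ = 0
      rcases Nat.eq_zero_or_pos (e' 1) with h1 | h1
      · rw [h1, pow_zero, one_mul, Polynomial.algebraMap_apply, Polynomial.coeff_C_mul_X_pow,
          if_neg]
        intro h2
        apply hne
        have a1 := hq.apply_add he
        have a2 := hq.apply_add he'
        ext i
        fin_cases i
        · change e' 0 = e 0
          omega
        · exact h1.trans h0.symm
        · exact h2.symm
      · simp [zero_pow h1.ne']
  rw [h2, Polynomial.coeff_zero] at h3
  exact MvPolynomial.mem_support_iff.1 he h3.symm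

theorem exists_isHomogeneous_dehom_eq {K : Type*} [CommRing K] (U : K[X][X]) :
    ∃ N, ∀ n ≥ N, ∃ q : MvPolynomial (Fin 3) K, q.IsHomogeneous n ∧ dehom K q = U := by
  induction U using Polynomial.induction_on' with
  | add p q hp hq =>
    obtain ⟨N₁, h₁⟩ := hp
    obtain ⟨N₂, h₂⟩ := hq
    refine ⟨max N₁ N₂, fun n hn => ?_⟩
    obtain ⟨a, ha, rfl⟩ := h₁ n (le_trans (le_max_left _ _) hn)
    obtain ⟨b, hb, rfl⟩ := h₂ n (le_trans (le_max_right _ _) hn)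
    exact ⟨a + b, ha.add hb, map_add _ _ _⟩
  | monomial k r =>
    refine ⟨r.natDegree + k, fun n hn => ?_⟩
    obtain ⟨c, rfl⟩ := Nat.exists_eq_add_of_le hn
    refine ⟨∑ j ∈ Finset.range (r.natDegree + 1), C (r.coeff j) *
      (X 0 ^ j * (X 1 ^ (r.natDegree - j + c) * X 2 ^ k)),
      IsHomogeneous.sum _ _ _ fun j hj => ?_, ?_⟩
    · have hj' := Finset.mem_range.1 hj
      have := ((isHomogeneous_X_pow (R := K) (0 : Fin 3) j).mul
        ((isHomogeneous_X_pow (R := K) (1 : Fin 3) (r.natDegree - j + c)).mul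
        (isHomogeneous_X_pow (R := K) (2 : Fin 3) k))).C_mul (r.coeff j)
      rwa [show j + (r.natDegree - j + c + k) = r.natDegree + k + c by omega] at this
    · rw [← Polynomial.C_mul_X_pow_eq_monomial]
      conv_rhs => rw [r.as_sum_range_C_mul_X_pow]
      simp [dehom, Finset.sum_mul, Polynomial.algebraMap_apply, mul_assoc]

/-- The degree of a polynomial in two variables can be read off on a generic line. -/
theorem exists_isHomogeneous_of_natDegree_lineRestrict {K : Type*} [Field K] {E : Type*}
    [CommRing E] [Algebra K E] {σ : E} (τ : E) (hσ : Transcendental K σ)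
    {q : MvPolynomial (Fin 3) K} {n N : ℕ} (hq : q.IsHomogeneous (n + N))
    (hn : (lineRestrict K σ τ q).natDegree ≤ n) :
    ∃ q' : MvPolynomial (Fin 3) K, q'.IsHomogeneous n ∧ dehom K q' = dehom K q := by
  induction N generalizing q with
  | zero => exact ⟨q, hq, rfl⟩
  | succ N ih =>
    have h1 : aeval ![1, 0, σ] q = 0 := by
      rw [← lineRestrict_coeff_top σ τ hq]
      exact Polynomial.coeff_eq_zero_of_natDegree_lt (lt_of_le_of_lt hn (by omega))
    obtain ⟨p, rfl⟩ := X_one_dvd_of_aeval_eq_zero hσ hq h1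
    have h2 := homogeneousComponent_mul_left (q := p) (isHomogeneous_X K (1 : Fin 3)) (n + N)
    rw [show 1 + (n + N) = n + (N + 1) by omega, homogeneousComponent_eq_self hq] at h2
    have h3 : p = homogeneousComponent (n + N) p := mul_left_cancel₀ (X_ne_zero _) h2
    have h4 : p.IsHomogeneous (n + N) := h3 ▸ homogeneousComponent_isHomogeneous _ _
    obtain ⟨q', h5, h6⟩ := ih h4 (by simpa [lineRestrict] using hn)
    exact ⟨q', h5, by rw [h6]; simp [dehom]⟩

/-- Substitution homomorphism on polynomials in three variables. -/
noncomputable def triSubst {K : Type*} [CommRing K] (a b c : K[X][X][X]) :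
    K[X][X][X] →+* K[X][X][X] :=
  Polynomial.eval₂RingHom (Polynomial.eval₂RingHom (Polynomial.eval₂RingHom
    (algebraMap K K[X][X][X]) a) b) c

section triSubst
variable {K : Type*} [CommRing K] (a b c : K[X][X][X])

@[simp]
theorem triSubst_C_C_C (r : K) :
    triSubst a b c (Polynomial.C (Polynomial.C (Polynomial.C r))) =
      Polynomial.C (Polynomial.C (Polynomial.C r)) := by
  simp [triSubst, Polynomial.algebraMap_apply]

@[simp]
theorem triSubst_C_C_X : triSubst a b c (Polynomial.C (Polynomial.C Polynomial.X)) = a := by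
  simp [triSubst]

@[simp]
theorem triSubst_C_X : triSubst a b c (Polynomial.C Polynomial.X) = b := by
  simp [triSubst]

@[simp]
theorem triSubst_X : triSubst a b c Polynomial.X = c := by
  simp [triSubst]

end triSubst

/-- The coordinate change from `K[x][z][s]` to `K[s][t][x]` with `z = s x + t`. -/
noncomputable def toLineCoord (K : Type*) [CommRing K] : K[X][X][X] →+* K[X][X][X] :=
  triSubst Polynomial.X
    (Polynomial.C (Polynomial.C Polynomial.X) * Polynomial.X + Polynomial.C Polynomial.X)
    (Polynomial.C (Polynomial.C Polynomial.X))

/-- The inverse coordinate change from `K[s][t][x]` to `K[x][z][s]`. -/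
noncomputable def ofLineCoord (K : Type*) [CommRing K] : K[X][X][X] →+* K[X][X][X] :=
  triSubst Polynomial.X
    (Polynomial.C Polynomial.X + Polynomial.C (Polynomial.C (Polynomial.C (-1))) *
      (Polynomial.X * Polynomial.C (Polynomial.C Polynomial.X)))
    (Polynomial.C (Polynomial.C Polynomial.X))

theorem C_C_C_neg_one {K : Type*} [CommRing K] :
    (Polynomial.C (Polynomial.C (Polynomial.C (-1))) : K[X][X][X]) = -1 := by
  rw [Polynomial.C_neg, Polynomial.C_neg, Polynomial.C_neg]
  simp

theorem triSubst_comp_eq_id {K : Type*} [CommRing K] {φ : K[X][X][X] →+* K[X][X][X]}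
    (h : ∀ r, φ (Polynomial.C (Polynomial.C (Polynomial.C r))) =
      Polynomial.C (Polynomial.C (Polynomial.C r)))
    (h1 : φ (Polynomial.C (Polynomial.C Polynomial.X)) =
      Polynomial.C (Polynomial.C Polynomial.X))
    (h2 : φ (Polynomial.C Polynomial.X) = Polynomial.C Polynomial.X)
    (h3 : φ Polynomial.X = Polynomial.X) (p : K[X][X][X]) : φ p = p := by
  have : φ = RingHom.id _ := by
    refine Polynomial.ringHom_ext' (Polynomial.ringHom_ext' (Polynomial.ringHom_ext'
      (RingHom.ext h) h1) h2) h3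
  rw [this, RingHom.id_apply]

theorem toLineCoord_ofLineCoord {K : Type*} [CommRing K] (p : K[X][X][X]) :
    toLineCoord K (ofLineCoord K p) = p := by
  refine triSubst_comp_eq_id (φ := (toLineCoord K).comp (ofLineCoord K)) (fun r => ?_) ?_ ?_ ?_ p
  · simp [toLineCoord, ofLineCoord]
  · simp [toLineCoord, ofLineCoord]
  · simp only [RingHom.comp_apply, ofLineCoord, toLineCoord, triSubst_C_X, map_add, map_mul,
      triSubst_C_C_C, triSubst_C_C_X, triSubst_X]
    rw [C_C_C_neg_one]
    ring
  · simp [toLineCoord, ofLineCoord]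

theorem ofLineCoord_toLineCoord {K : Type*} [CommRing K] (p : K[X][X][X]) :
    ofLineCoord K (toLineCoord K p) = p := by
  refine triSubst_comp_eq_id (φ := (ofLineCoord K).comp (toLineCoord K)) (fun r => ?_) ?_ ?_ ?_ p
  · simp [toLineCoord, ofLineCoord]
  · simp [toLineCoord, ofLineCoord]
  · simp only [RingHom.comp_apply, ofLineCoord, toLineCoord, triSubst_C_X, map_add, map_mul,
      triSubst_C_C_X, triSubst_X]
    rw [C_C_C_neg_one]
    ring
  · simp [toLineCoord, ofLineCoord]

theorem toLineCoord_C_dehom {K : Type*} [CommRing K] (q : MvPolynomial (Fin 3) K) :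
    toLineCoord K (Polynomial.C (dehom K q)) =
      lineRestrict K (Polynomial.C Polynomial.X : K[X][X]) Polynomial.X q := by
  have : ((toLineCoord K).comp Polynomial.C).comp (dehom K).toRingHom =
      (lineRestrict K (Polynomial.C Polynomial.X : K[X][X]) Polynomial.X).toRingHom := by
    refine MvPolynomial.ringHom_ext (fun r => ?_) fun i => ?_
    · simp [toLineCoord, dehom, lineRestrict, MvPolynomial.algHom_C, Polynomial.algebraMap_apply]
    · fin_cases i
      · simp [toLineCoord, dehom, lineRestrict]
      · simp [toLineCoord, dehom, lineRestrict]
      · simp [toLineCoord, dehom, lineRestrict]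
  exact DFunLike.congr_fun this q

/-- The derivative along the pencil of lines through a point, in line coordinates. -/
noncomputable def pencilDeriv (K : Type*) [CommRing K] (p : K[X][X][X]) : K[X][X][X] :=
  toLineCoord K (Polynomial.derivative (ofLineCoord K p))

theorem pencilDeriv_mul {K : Type*} [CommRing K] (p q : K[X][X][X]) :
    pencilDeriv K (p * q) = pencilDeriv K p * q + p * pencilDeriv K q := by
  simp [pencilDeriv, Polynomial.derivative_mul, toLineCoord_ofLineCoord]

theorem pencilDeriv_add {K : Type*} [CommRing K] (p q : K[X][X][X]) :
    pencilDeriv K (p + q) = pencilDeriv K p + pencilDeriv K q := by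
  simp [pencilDeriv]

theorem pencilDeriv_X_pow {K : Type*} [CommRing K] (k : ℕ) :
    pencilDeriv K (Polynomial.X ^ k) = 0 := by
  rw [pencilDeriv, ofLineCoord, map_pow, triSubst_X, ← Polynomial.C_pow, ← Polynomial.C_pow,
    Polynomial.derivative_C, map_zero]

theorem natDegree_pencilDeriv_C_mul_le {K : Type*} [CommRing K] {a b : K[X][X]}
    (ha : (pencilDeriv K (Polynomial.C a)).natDegree ≤ 1)
    (hb : (pencilDeriv K (Polynomial.C b)).natDegree ≤ 1) :
    (pencilDeriv K (Polynomial.C (a * b))).natDegree ≤ 1 := by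
  rw [Polynomial.C_mul, pencilDeriv_mul]
  exact Polynomial.natDegree_add_le_of_degree_le ((Polynomial.natDegree_mul_C_le _ _).trans ha)
    ((Polynomial.natDegree_C_mul_le _ _).trans hb)

theorem natDegree_pencilDeriv_C_le {K : Type*} [CommRing K] (c : K[X][X]) :
    (pencilDeriv K (Polynomial.C c)).natDegree ≤ 1 := by
  have hadd : ∀ a b : K[X][X], (pencilDeriv K (Polynomial.C a)).natDegree ≤ 1 →
      (pencilDeriv K (Polynomial.C b)).natDegree ≤ 1 →
      (pencilDeriv K (Polynomial.C (a + b))).natDegree ≤ 1 := fun a b ha hb => by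
    rw [Polynomial.C_add, pencilDeriv_add]
    exact Polynomial.natDegree_add_le_of_degree_le ha hb
  induction c using Polynomial.induction_on with
  | add p q hp hq => exact hadd p q hp hq
  | monomial n a h =>
    rw [pow_succ, ← mul_assoc]
    refine natDegree_pencilDeriv_C_mul_le h ?_
    simp only [pencilDeriv, ofLineCoord, toLineCoord, triSubst_C_X, map_add, map_mul,
      Polynomial.derivative_mul, Polynomial.derivative_C, Polynomial.derivative_X, triSubst_C_C_C,
      triSubst_C_C_X, zero_mul, mul_zero, zero_add, one_mul, add_zero]
    exact (Polynomial.natDegree_C_mul_le _ _).trans Polynomial.natDegree_X_le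
  | C a =>
    induction a using Polynomial.induction_on with
    | add p q hp hq => rw [Polynomial.C_add]; exact hadd _ _ hp hq
    | monomial n a h =>
      rw [pow_succ, ← mul_assoc, Polynomial.C_mul]
      refine natDegree_pencilDeriv_C_mul_le h ?_
      simp [pencilDeriv, ofLineCoord]
    | C a => simp [pencilDeriv, ofLineCoord]

theorem pencilDeriv_coeff_eq_zero {K : Type*} [CommRing K] {p : K[X][X][X]} {m : ℕ}
    (hp : ∀ k, m ≤ k → p.coeff k = 0) (k : ℕ) (hk : m + 1 ≤ k) :
    (pencilDeriv K p).coeff k = 0 := by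
  let Δ : K[X][X][X] →+ K[X][X][X] := AddMonoidHom.mk' (pencilDeriv K) pencilDeriv_add
  change (Δ p).coeff k = 0
  rw [p.as_sum_support_C_mul_X_pow, map_sum, Polynomial.finsetSum_coeff]
  refine Finset.sum_eq_zero fun i hi => ?_
  have him : i < m := by
    by_contra h
    exact Polynomial.mem_support_iff.1 hi (hp i (not_lt.1 h))
  change (pencilDeriv K _).coeff k = 0
  rw [pencilDeriv_mul, pencilDeriv_X_pow, mul_zero, add_zero, Polynomial.coeff_mul_X_pow',
    if_pos (by omega)]
  exact Polynomial.coeff_eq_zero_of_natDegree_lt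
    (lt_of_le_of_lt (natDegree_pencilDeriv_C_le _) (by omega))

theorem exists_smul_primitive {E ι : Type*} [CommRing E] [IsDomain E]
    [UniqueFactorizationMonoid E] [Fintype ι] {u : ι → E} (hu : u ≠ 0) :
    ∃ (e : E) (v : ι → E), e ≠ 0 ∧ u = e • v ∧ ∀ x y, (∀ i, x ∣ y * v i) → x ∣ y := by
  classical
  let _ : StrongNormalizationMonoid E := UniqueFactorizationMonoid.strongNormalizationMonoid
  let _ : NormalizedGCDMonoid E := UniqueFactorizationMonoid.toNormalizedGCDMonoid E
  obtain ⟨i, hi⟩ := Function.ne_iff.1 hu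
  obtain ⟨v, hv, hv1⟩ := Finset.extract_gcd u (s := Finset.univ) ⟨i, Finset.mem_univ i⟩
  refine ⟨_, v, fun h0 => hi ?_, _root_.funext fun i => hv i (Finset.mem_univ i),
    fun x y h => ?_⟩
  · exact Finset.gcd_eq_zero_iff.1 h0 i (Finset.mem_univ i)
  · have h1 := Finset.dvd_gcd (s := Finset.univ) (f := fun i => y * v i) (fun i _ => h i)
    have h2 := Finset.gcd_mul_left' (s := Finset.univ) (f := v) (a := y)
    rw [hv1, mul_one] at h2
    exact h1.trans h2.dvd

theorem derivative_eq_zero_of_primitive {E ι : Type*} [CommRing E] [IsDomain E]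
    {v : ι → E[X]} (hv : ∀ x y, (∀ i, x ∣ y * v i) → x ∣ y)
    (h : ∀ i k, v i * Polynomial.derivative (v k) = v k * Polynomial.derivative (v i)) (k : ι) :
    Polynomial.derivative (v k) = 0 := by
  by_cases h0 : (v k).natDegree = 0
  · rw [Polynomial.eq_C_of_natDegree_eq_zero h0, Polynomial.derivative_C]
  · refine Polynomial.eq_zero_of_dvd_of_natDegree_lt (hv _ _ fun i =>
      ⟨Polynomial.derivative (v i), ?_⟩) (Polynomial.natDegree_derivative_lt h0)
    rw [mul_comm, h]

theorem exists_homogeneous_syzygy {K : Type*} [Field K] [CharZero K]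
    {f : Fin 3 → MvPolynomial (Fin 3) K} {d : Fin 3 → ℕ} (hf : ∀ i, (f i).IsHomogeneous (d i))
    {a : ℕ} {g : Fin 3 → K[X][X][X]} (hg0 : g ≠ 0) (hg : ShiftedDegLT d (a + 1) g)
    {fbar : Fin 3 → K[X][X][X]} (hfbar : ∀ i, fbar i =
      lineRestrict K (Polynomial.C Polynomial.X : K[X][X]) Polynomial.X (f i))
    (hgf : g ⬝ᵥ fbar = 0)
    (hrank : ∀ u v, ShiftedDegLT d (a + 2) u → ShiftedDegLT d (a + 2) v → u ⬝ᵥ fbar = 0 →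
      v ⬝ᵥ fbar = 0 → crossProduct u v = 0) :
    ∃ U : Fin 3 → MvPolynomial (Fin 3) K, (∀ i, (U i).IsHomogeneous (a - d i)) ∧
      (∀ i, a < d i → U i = 0) ∧ U ⬝ᵥ f = 0 ∧ ∃ i,
      lineRestrict K (Polynomial.C Polynomial.X : K[X][X]) Polynomial.X (U i) ≠ 0 := by
  have hθinj : Function.Injective (toLineCoord K) :=
    Function.LeftInverse.injective ofLineCoord_toLineCoord
  have hηinj : Function.Injective (ofLineCoord K) :=
    Function.LeftInverse.injective toLineCoord_ofLineCoord
  have hu0 : (fun i => ofLineCoord K (g i)) ≠ 0 := by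
    intro h
    refine hg0 (_root_.funext fun i => hηinj ?_)
    rw [Pi.zero_apply, map_zero]
    exact congrFun h i
  obtain ⟨e, v, he, hev, hv⟩ := exists_smul_primitive (E := K[X][X][X]) hu0
  have hgv : g = toLineCoord K e • fun i => toLineCoord K (v i) := by
    ext1 i
    rw [Pi.smul_apply, smul_eq_mul, ← map_mul, ← smul_eq_mul, ← Pi.smul_apply, ← hev,
      toLineCoord_ofLineCoord]
  have hθe : toLineCoord K e ≠ 0 := (map_ne_zero_iff _ hθinj).2 he
  have hvdeg : ShiftedDegLT d (a + 1) fun i => toLineCoord K (v i) := by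
    rw [hgv] at hg
    exact hg.of_smul hθe
  have hvf : (fun i => toLineCoord K (v i)) ⬝ᵥ fbar = 0 := by
    rw [hgv, smul_dotProduct] at hgf
    exact (smul_eq_zero.1 hgf).resolve_left hθe
  have hfC : ∀ i, fbar i = toLineCoord K (Polynomial.C (dehom K (f i))) := fun i => by
    rw [hfbar, toLineCoord_C_dehom]
  have hvF : ∑ i, v i * Polynomial.C (dehom K (f i)) = 0 := by
    refine hθinj ?_
    simp only [map_sum, map_mul, map_zero, ← hfC]
    exact hvf
  have hwf : (fun i => toLineCoord K (Polynomial.derivative (v i))) ⬝ᵥ fbar = 0 := by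
    have := congrArg (fun p => toLineCoord K (Polynomial.derivative p)) hvF
    simpa [dotProduct, hfC, Polynomial.derivative_sum] using this
  have hcross := hrank _ _ (fun i k hk => hvdeg i k (by omega)) (fun i k hk => by
    have := pencilDeriv_coeff_eq_zero (p := toLineCoord K (v i)) (m := a + 1 - d i)
      (fun k hk => hvdeg i k (by omega)) k
    rw [pencilDeriv, ofLineCoord_toLineCoord] at this
    by_cases h : d i ≤ a + 1
    · exact this (by omega)
    · have hvi : v i = 0 := by
        refine hθinj (Polynomial.ext fun k => ?_)
        rw [map_zero, Polynomial.coeff_zero]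
        exact hvdeg i k (by omega)
      simp [hvi]) hvf hwf
  have hder := derivative_eq_zero_of_primitive hv fun i k => hθinj (by
    simpa using crossProduct_eq_zero_iff_mul.1 hcross i k)
  have hC : ∀ i, ∃ G, v i = Polynomial.C G := fun i =>
    ⟨_, Polynomial.eq_C_of_natDegree_eq_zero
      (Polynomial.derivative_eq_zero.1 (hder i))⟩
  choose G hG using hC
  have htr : Transcendental K (Polynomial.C Polynomial.X : K[X][X]) :=
    (transcendental_algebraMap_iff (R := K) (S := K[X]) (A := K[X][X])
      Polynomial.C_injective).2 (Polynomial.transcendental_X K)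
  have hU : ∀ i, ∃ q : MvPolynomial (Fin 3) K, q.IsHomogeneous (a - d i) ∧ dehom K q = G i := by
    intro i
    obtain ⟨N, hN⟩ := exists_isHomogeneous_dehom_eq (G i)
    obtain ⟨q, hq, hqG⟩ := hN (a - d i + N) (by omega)
    obtain ⟨q', hq', h⟩ := exists_isHomogeneous_of_natDegree_lineRestrict
      (Polynomial.X : K[X][X]) htr hq (by
        rw [← toLineCoord_C_dehom, hqG, ← hG, Polynomial.natDegree_le_iff_coeff_eq_zero]
        exact fun k hk => hvdeg i k (by omega))
    exact ⟨q', hq', h.trans hqG⟩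
  choose U hUh hUG using hU
  have hUv : ∀ i, lineRestrict K (Polynomial.C Polynomial.X : K[X][X]) Polynomial.X (U i) =
      toLineCoord K (v i) := fun i => by rw [← toLineCoord_C_dehom, hUG, ← hG]
  have hU0 : ∀ i, a < d i → U i = 0 := fun i hi => by
    refine dehom_injective_of_isHomogeneous (hUh i) ?_
    have : v i = 0 := by
      refine hθinj (Polynomial.ext fun k => ?_)
      rw [map_zero, Polynomial.coeff_zero]
      exact hvdeg i k (by omega)
    rw [hUG, ← Polynomial.C_eq_zero, ← hG, this]
  refine ⟨U, hUh, hU0, ?_, ?_⟩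
  · refine dehom_injective_of_isHomogeneous (n := a) (IsHomogeneous.sum _ _ _ fun i _ => ?_) ?_
    · by_cases hi : a < d i
      · rw [hU0 i hi, zero_mul]
        exact isHomogeneous_zero _ _ _
      · have := (hUh i).mul (hf i)
        rwa [Nat.sub_add_cancel (not_lt.1 hi)] at this
    · refine Polynomial.C_injective ?_
      simpa [dotProduct, hUG, hG] using hvF
  · by_contra! h
    refine hg0 ?_
    rw [hgv]
    ext1 i
    rw [Pi.smul_apply, ← hUv, h, smul_zero, Pi.zero_apply]

theorem exists_leftInverse_mul_eq_smul {P m n : Type*} [CommRing P] [IsDomain P] [Fintype m]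
    [Fintype n] [DecidableEq n] (M : Matrix m n P) (hM : ∀ v, M.mulVec v = 0 → v = 0) :
    ∃ (N : Matrix n m P) (δ : P), δ ≠ 0 ∧ N * M = δ • 1 := by
  classical
  let F := FractionRing P
  have hinj : Function.Injective (algebraMap P F) := IsFractionRing.injective P F
  have hker : LinearMap.ker (M.map (algebraMap P F)).mulVecLin = ⊥ := by
    rw [LinearMap.ker_eq_bot']
    intro v hv
    obtain ⟨b, hb⟩ := IsLocalization.exist_integer_multiples_of_finite (nonZeroDivisors P) v
    choose w hw using hb
    have hb0 : (b : P) ≠ 0 := nonZeroDivisors.ne_zero b.2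
    have hw' : (algebraMap P F) ∘ w = (b : P) • v := _root_.funext hw
    have h1 : M.mulVec w = 0 := by
      have h2 : (algebraMap P F) ∘ M.mulVec w = 0 := by
        rw [Matrix.mulVecLin_apply] at hv
        ext i
        rw [Function.comp_apply, RingHom.map_mulVec, hw', Matrix.mulVec_smul, hv, smul_zero]
      ext i
      exact hinj (by simpa using congrFun h2 i)
    rw [hM w h1] at hw'
    have h3 : (b : P) • v = 0 := by
      rw [← hw']
      ext i
      simp
    exact (smul_eq_zero.1 h3).resolve_left hb0
  obtain ⟨g, hg⟩ := LinearMap.exists_leftInverse_of_injective _ hker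
  have hN : LinearMap.toMatrix' g * M.map (algebraMap P F) = 1 := by
    have := congrArg LinearMap.toMatrix' hg
    rwa [LinearMap.toMatrix'_comp, ← Matrix.toLin'_apply', LinearMap.toMatrix'_toLin',
      LinearMap.toMatrix'_id] at this
  obtain ⟨b, hb⟩ := IsLocalization.exist_integer_multiples_of_finite (nonZeroDivisors P)
    fun x : n × m => LinearMap.toMatrix' g x.1 x.2
  choose w hw using hb
  refine ⟨(Matrix.of fun i j => w (i, j) : Matrix n m P), b, nonZeroDivisors.ne_zero b.2, ?_⟩
  have hw' : (Matrix.of fun i j => w (i, j) : Matrix n m P).map (algebraMap P F) =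
      (b : P) • LinearMap.toMatrix' g := by
    ext i j
    exact hw (i, j)
  refine Matrix.map_injective hinj ?_
  change ((Matrix.of fun i j => w (i, j) : Matrix n m P) * M).map (algebraMap P F) =
    ((b : P) • (1 : Matrix n n P)).map (algebraMap P F)
  rw [Matrix.map_mul, hw', Matrix.smul_mul, hN]
  ext i j
  simp only [Matrix.map_apply, Matrix.smul_apply, Matrix.one_apply]
  split_ifs <;> simp [Algebra.smul_def]

theorem exists_mul_rightInverse_eq_smul {P F m n : Type*} [CommRing P] [IsDomain P] [Field F]
    [Algebra P F] [IsFractionRing P F] [Fintype m] [Fintype n] [DecidableEq m] (M : Matrix m n P)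
    (hM : ∀ w, ∃ v, (M.map (algebraMap P F)).mulVec v = w) :
    ∃ (N : Matrix n m P) (δ : P), δ ≠ 0 ∧ M * N = δ • 1 := by
  classical
  have hinj : Function.Injective (algebraMap P F) := IsFractionRing.injective P F
  obtain ⟨N, hN⟩ := Matrix.mulVec_surjective_iff_exists_right_inverse.1 hM
  obtain ⟨b, hb⟩ := IsLocalization.exist_integer_multiples_of_finite (nonZeroDivisors P)
    fun x : n × m => N x.1 x.2
  choose w hw using hb
  refine ⟨(Matrix.of fun i j => w (i, j) : Matrix n m P), b, nonZeroDivisors.ne_zero b.2, ?_⟩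
  have hw' : (Matrix.of fun i j => w (i, j) : Matrix n m P).map (algebraMap P F) =
      (b : P) • N := by
    ext i j
    exact hw (i, j)
  refine Matrix.map_injective hinj ?_
  change (M * (Matrix.of fun i j => w (i, j) : Matrix n m P)).map (algebraMap P F) =
    ((b : P) • (1 : Matrix m m P)).map (algebraMap P F)
  rw [Matrix.map_mul, hw', Matrix.mul_smul, hN]
  ext i j
  simp only [Matrix.map_apply, Matrix.smul_apply, Matrix.one_apply]
  split_ifs <;> simp [Algebra.smul_def]

/-- The monomials `(i, k)` allowed by `ShiftedDegLT d n`. -/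
abbrev ShiftedIdx (d : Fin 3 → ℕ) (n : ℕ) : Type :=
  {x : Fin 3 × Fin n // x.2 + d x.1 < n}

/-- The matrix of the map `u ↦ u ⬝ᵥ f` on vectors with shifted degree bounds. -/
noncomputable def coeffMatrix {E : Type*} [CommRing E] (d : Fin 3 → ℕ) (n : ℕ) (f : Fin 3 → E[X]) :
    Matrix (Fin n) (ShiftedIdx d n) E :=
  Matrix.of fun r x => (Polynomial.X ^ (x.1.2 : ℕ) * f x.1.1).coeff r

/-- The vector of polynomials with given coefficients. -/
noncomputable def vecOfCoeff {E : Type*} [CommRing E] {d : Fin 3 → ℕ} {n : ℕ}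
    (v : ShiftedIdx d n → E) (i : Fin 3) : E[X] :=
  ∑ x, if x.1.1 = i then Polynomial.C (v x) * Polynomial.X ^ (x.1.2 : ℕ) else 0

theorem coeff_vecOfCoeff {E : Type*} [CommRing E] {d : Fin 3 → ℕ} {n : ℕ}
    (v : ShiftedIdx d n → E) (x : ShiftedIdx d n) :
    (vecOfCoeff v x.1.1).coeff x.1.2 = v x := by
  rw [vecOfCoeff, Polynomial.finsetSum_coeff, Finset.sum_eq_single x]
  · simp
  · intro y _ hy
    split_ifs with h
    · rw [Polynomial.coeff_C_mul_X_pow, if_neg]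
      intro h1
      exact hy (Subtype.ext (Prod.ext h (Fin.ext h1.symm)))
    · simp
  · simp

theorem shiftedDegLT_vecOfCoeff {E : Type*} [CommRing E] {d : Fin 3 → ℕ} {n : ℕ}
    (v : ShiftedIdx d n → E) : ShiftedDegLT d n (vecOfCoeff v) := by
  intro i k hk
  rw [vecOfCoeff, Polynomial.finsetSum_coeff]
  refine Finset.sum_eq_zero fun x _ => ?_
  split_ifs with h
  · rw [Polynomial.coeff_C_mul_X_pow, if_neg]
    intro h1
    have := x.2
    rw [h] at this
    omega
  · simp

theorem vecOfCoeff_coeff {E : Type*} [CommRing E] {d : Fin 3 → ℕ} {n : ℕ} {u : Fin 3 → E[X]}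
    (hu : ShiftedDegLT d n u) :
    vecOfCoeff (fun x : ShiftedIdx d n => (u x.1.1).coeff x.1.2) = u := by
  ext i k
  by_cases hk : n ≤ k + d i
  · rw [hu i k hk, shiftedDegLT_vecOfCoeff _ i k hk]
  · exact coeff_vecOfCoeff (fun x : ShiftedIdx d n => (u x.1.1).coeff x.1.2)
      ⟨(i, ⟨k, by omega⟩), not_le.1 hk⟩

theorem coeff_vecOfCoeff_dotProduct {E : Type*} [CommRing E] {d : Fin 3 → ℕ} {n : ℕ}
    (v : ShiftedIdx d n → E) (f : Fin 3 → E[X]) (r : Fin n) :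
    (vecOfCoeff v ⬝ᵥ f).coeff r = (coeffMatrix d n f).mulVec v r := by
  have : vecOfCoeff v ⬝ᵥ f =
      ∑ x, Polynomial.C (v x) * (Polynomial.X ^ (x.1.2 : ℕ) * f x.1.1) := by
    simp only [dotProduct, vecOfCoeff, Finset.sum_mul, ite_mul, zero_mul]
    rw [Finset.sum_comm]
    refine Finset.sum_congr rfl fun x _ => ?_
    rw [Finset.sum_ite_eq, if_pos (Finset.mem_univ _), mul_assoc]
  rw [this, Polynomial.finsetSum_coeff, Matrix.mulVec, dotProduct]
  refine Finset.sum_congr rfl fun x _ => ?_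
  rw [Polynomial.coeff_C_mul, mul_comm, coeffMatrix, Matrix.of_apply]

theorem coeff_dotProduct_eq_zero {E : Type*} [CommRing E] {d : Fin 3 → ℕ} {n : ℕ}
    {f u : Fin 3 → E[X]} (hf : ∀ i, (f i).natDegree ≤ d i) (hu : ShiftedDegLT d n u) (k : ℕ)
    (hk : n ≤ k) : (u ⬝ᵥ f).coeff k = 0 := by
  rw [dotProduct, Polynomial.finsetSum_coeff]
  refine Finset.sum_eq_zero fun i _ => ?_
  refine coeff_mul_eq_zero_of_shifted (a := d i) (b := 0) (n := n) (n' := d i + 1)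
    (fun k hk => hu i k hk) (fun k hk => ?_) k (by omega)
  exact Polynomial.coeff_eq_zero_of_natDegree_lt (lt_of_le_of_lt (hf i) (by omega))

theorem vecOfCoeff_dotProduct_eq_iff {E : Type*} [CommRing E] {d : Fin 3 → ℕ} {n : ℕ}
    {f : Fin 3 → E[X]} (hf : ∀ i, (f i).natDegree ≤ d i) (v : ShiftedIdx d n → E) {q : E[X]}
    (hq : q ∈ Polynomial.degreeLT E n) :
    vecOfCoeff v ⬝ᵥ f = q ↔ (coeffMatrix d n f).mulVec v = fun r : Fin n => q.coeff r := by
  constructor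
  · rintro rfl
    ext r
    exact (coeff_vecOfCoeff_dotProduct v f r).symm
  · intro h
    ext k
    by_cases hk : k < n
    · rw [← show _ = q.coeff k from congrFun h ⟨k, hk⟩, ← coeff_vecOfCoeff_dotProduct]
    · rw [coeff_dotProduct_eq_zero hf (shiftedDegLT_vecOfCoeff v) k (not_lt.1 hk)]
      exact ((Polynomial.degree_lt_iff_coeff_zero _ _).1 (Polynomial.mem_degreeLT.1 hq) k
        (not_lt.1 hk)).symm

theorem coeffMatrix_map {E E' : Type*} [CommRing E] [CommRing E'] (φ : E →+* E')
    (d : Fin 3 → ℕ) (n : ℕ) (f : Fin 3 → E[X]) :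
    (coeffMatrix d n f).map φ = coeffMatrix d n fun i => (f i).map φ := by
  ext r x
  simp [coeffMatrix, Polynomial.coeff_X_pow_mul', apply_ite φ]

/-- The absence of syzygies in a given degree specializes away from a hypersurface. -/
theorem exists_specialization_of_no_syzygy {P : Type*} [CommRing P] [IsDomain P]
    {d : Fin 3 → ℕ} {n : ℕ} {f : Fin 3 → P[X]} (hf : ∀ i, (f i).natDegree ≤ d i)
    (h : ∀ u, ShiftedDegLT d n u → u ⬝ᵥ f = 0 → u = 0) (k : Type*) [Field k] :
    ∃ δ : P, δ ≠ 0 ∧ ∀ φ : P →+* k, φ δ ≠ 0 → ∀ u, ShiftedDegLT d n u →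
      (u ⬝ᵥ fun i => (f i).map φ) = 0 → u = 0 := by
  obtain ⟨N, δ, hδ, hN⟩ := exists_leftInverse_mul_eq_smul (coeffMatrix d n f) fun v hv => by
    have h1 := h _ (shiftedDegLT_vecOfCoeff v)
      ((vecOfCoeff_dotProduct_eq_iff hf v (Submodule.zero_mem _)).2 (by rw [hv]; ext; simp))
    ext x
    rw [← coeff_vecOfCoeff v x, h1]
    simp
  refine ⟨δ, hδ, fun φ hφ u hu huf => ?_⟩
  have hf' : ∀ i, ((f i).map φ).natDegree ≤ d i := fun i =>
    Polynomial.natDegree_map_le.trans (hf i)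
  rw [← vecOfCoeff_coeff hu] at huf ⊢
  have h1 := (vecOfCoeff_dotProduct_eq_iff hf' _ (Submodule.zero_mem _)).1 huf
  rw [← coeffMatrix_map] at h1
  have h2 := congrArg (fun M => (M.map φ).mulVec fun x => (u x.1.1).coeff x.1.2) hN
  simp only [Matrix.map_mul, ← Matrix.mulVec_mulVec] at h2
  have h3 : (δ • (1 : Matrix (ShiftedIdx d n) (ShiftedIdx d n) P)).map φ = φ δ • 1 := by
    ext i j
    simp [Matrix.one_apply, apply_ite φ]
  rw [h1, h3, Matrix.smul_mulVec, Matrix.one_mulVec] at h2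
  have h4 : (fun x : ShiftedIdx d n => (u x.1.1).coeff x.1.2) = 0 := by
    refine (smul_eq_zero.1 (h2.symm.trans ?_)).resolve_left hφ
    ext i
    simp [Matrix.mulVec, dotProduct]
  rw [h4]
  ext i
  simp [vecOfCoeff]

/-- Generation in a given degree specializes away from a hypersurface. -/
theorem exists_specialization_of_generates {P F : Type*} [CommRing P] [IsDomain P] [Field F]
    [Algebra P F] [IsFractionRing P F]
    {d : Fin 3 → ℕ} {n : ℕ} {f : Fin 3 → P[X]} (hf : ∀ i, (f i).natDegree ≤ d i)
    (h : GeneratesDegLT d (fun i => (f i).map (algebraMap P F)) n) (k : Type*) [Field k] :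
    ∃ δ : P, δ ≠ 0 ∧ ∀ φ : P →+* k, φ δ ≠ 0 →
      GeneratesDegLT d (fun i => (f i).map φ) n := by
  obtain ⟨N, δ, hδ, hN⟩ := exists_mul_rightInverse_eq_smul (F := F) (coeffMatrix d n f)
    fun w => by
      have hq : ∑ r : Fin n, Polynomial.C (w r) * Polynomial.X ^ (r : ℕ) ∈
          Polynomial.degreeLT F n := Submodule.sum_mem _ fun r _ =>
        Polynomial.mem_degreeLT.2 (lt_of_le_of_lt (Polynomial.degree_C_mul_X_pow_le _ _)
          (by exact_mod_cast r.2))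
      obtain ⟨u, hu, huf⟩ := h _ hq
      refine ⟨fun x : ShiftedIdx d n => (u x.1.1).coeff x.1.2, ?_⟩
      rw [coeffMatrix_map]
      rw [← vecOfCoeff_coeff hu] at huf
      rw [(vecOfCoeff_dotProduct_eq_iff (fun i => Polynomial.natDegree_map_le.trans (hf i))
        _ hq).1 huf]
      ext r
      rw [Polynomial.finsetSum_coeff, Finset.sum_eq_single r]
      · simp
      · intro s _ hs
        rw [Polynomial.coeff_C_mul_X_pow, if_neg]
        exact fun h => hs (Fin.ext h.symm)
      · simp
  refine ⟨δ, hδ, fun φ hφ q hq => ?_⟩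
  refine ⟨vecOfCoeff ((N.map φ).mulVec fun r => (φ δ)⁻¹ * q.coeff r),
    shiftedDegLT_vecOfCoeff _, (vecOfCoeff_dotProduct_eq_iff
      (fun i => Polynomial.natDegree_map_le.trans (hf i)) _ hq).2 ?_⟩
  have h3 : (δ • (1 : Matrix (Fin n) (Fin n) P)).map φ = φ δ • 1 := by
    ext i j
    simp [Matrix.one_apply, apply_ite φ]
  rw [← coeffMatrix_map, Matrix.mulVec_mulVec, ← Matrix.map_mul, hN, h3, Matrix.smul_mulVec,
    Matrix.one_mulVec]
  ext r
  simp [hφ]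

theorem ShiftedDegLT.mono {E : Type*} [CommRing E] {d : Fin 3 → ℕ} {n n' : ℕ} {u : Fin 3 → E[X]}
    (hu : ShiftedDegLT d n u) (h : n ≤ n') : ShiftedDegLT d n' u :=
  fun i k hk => hu i k (h.trans hk)

theorem lineRestrict_map {K E E' : Type*} [CommRing K] [CommRing E] [CommRing E'] [Algebra K E]
    [Algebra K E'] (φ : E →ₐ[K] E') (σ τ : E) (q : MvPolynomial (Fin 3) K) :
    (lineRestrict K σ τ q).map (φ : E →+* E') = lineRestrict K (φ σ) (φ τ) q := by
  have h : (Polynomial.mapAlgHom φ).comp (lineRestrict K σ τ) =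
      lineRestrict K (φ σ) (φ τ) := by
    refine MvPolynomial.algHom_ext fun i => ?_
    fin_cases i <;> simp [lineRestrict]
  exact DFunLike.congr_fun h q

section line
variable {K E : Type*} [CommRing K] [CommRing E] [Algebra K E] {f : Fin 3 → MvPolynomial (Fin 3) K}

theorem exists_dotProduct_lineRestrict_eq_one {N : ℕ}
    (hN : (X 1 : MvPolynomial (Fin 3) K) ^ N ∈ Ideal.span (Set.range f)) (σ τ : E) :
    ∃ r : Fin 3 → E[X], (r ⬝ᵥ fun i => lineRestrict K σ τ (f i)) = 1 := by
  obtain ⟨c, hc⟩ := Ideal.mem_span_range_iff_exists_fun.1 hN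
  refine ⟨fun i => lineRestrict K σ τ (c i), ?_⟩
  have := congrArg (lineRestrict K σ τ) hc
  simp only [map_sum, map_mul, map_pow] at this
  rw [dotProduct, this]
  simp [lineRestrict]

theorem exists_coeff_lineRestrict_ne_zero [Nontrivial E] {d : Fin 3 → ℕ}
    (hf : ∀ i, (f i).IsHomogeneous (d i)) {N : ℕ}
    (hN : (X 0 : MvPolynomial (Fin 3) K) ^ N ∈ Ideal.span (Set.range f)) (σ τ : E) :
    ∃ i, (lineRestrict K σ τ (f i)).coeff (d i) ≠ 0 := by
  by_contra! h
  obtain ⟨c, hc⟩ := Ideal.mem_span_range_iff_exists_fun.1 hN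
  have := congrArg (aeval (R := K) ![1, 0, σ]) hc
  simp only [lineRestrict_coeff_top _ _ (hf _)] at h
  simp [h] at this

theorem shiftedDegLT_lineRestrict {d : Fin 3 → ℕ} {n : ℕ} {U : Fin 3 → MvPolynomial (Fin 3) K}
    (hU : ∀ i, (U i).IsHomogeneous (n - d i)) (hU0 : ∀ i, n < d i → U i = 0) (σ τ : E) :
    ShiftedDegLT d (n + 1) fun i => lineRestrict K σ τ (U i) := by
  intro i k hk
  by_cases h : n < d i
  · simp [hU0 i h]
  · exact Polynomial.coeff_eq_zero_of_natDegree_lt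
      (lt_of_le_of_lt (lineRestrict_natDegree_le σ τ (hU i)) (by omega))

/-- Membership of a form in an ideal generated by forms has homogeneous witnesses. -/
theorem exists_homogeneous_combination {d : Fin 3 → ℕ} (hf : ∀ i, (f i).IsHomogeneous (d i))
    {j : ℕ} {q : MvPolynomial (Fin 3) K} (hq : q.IsHomogeneous j)
    (hqI : q ∈ Ideal.span (Set.range f)) :
    ∃ g : Fin 3 → MvPolynomial (Fin 3) K, (∀ i, (g i).IsHomogeneous (j - d i)) ∧
      (∀ i, j < d i → g i = 0) ∧ g ⬝ᵥ f = q := by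
  obtain ⟨c, hc⟩ := Ideal.mem_span_range_iff_exists_fun.1 hqI
  refine ⟨fun i => if j < d i then 0 else homogeneousComponent (j - d i) (c i),
    fun i => ?_, fun i hi => if_pos hi, ?_⟩
  · dsimp only
    split_ifs
    · exact isHomogeneous_zero _ _ _
    · exact homogeneousComponent_isHomogeneous _ _
  · have h1 := congrArg (homogeneousComponent j) hc
    rw [homogeneousComponent_of_mem hq, if_pos rfl, map_sum] at h1
    rw [← h1, dotProduct]
    refine Finset.sum_congr rfl fun i _ => ?_
    rw [mul_comm (c i)]
    split_ifs with h
    · rw [homogeneousComponent_mul_left_of_lt (hf i) h, zero_mul]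
    · conv_rhs => rw [show j = d i + (j - d i) by omega]
      rw [homogeneousComponent_mul_left (hf i), mul_comm]

end line

/-- Lifting of a vector of univariate polynomials to a vector of forms. -/
theorem exists_isHomogeneous_lift {K : Type*} [CommRing K] {d : Fin 3 → ℕ} {j : ℕ}
    {u : Fin 3 → K[X]} (hu : ShiftedDegLT d (j + 1) u) (σ τ : K) :
    ∃ G : Fin 3 → MvPolynomial (Fin 3) K, (∀ i, (G i).IsHomogeneous (j - d i)) ∧
      (∀ i, j < d i → G i = 0) ∧ ∀ i, lineRestrict K σ τ (G i) = u i := by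
  have h : ∀ i, ∃ q : MvPolynomial (Fin 3) K, q.IsHomogeneous (j - d i) ∧ (j < d i → q = 0) ∧
      lineRestrict K σ τ q = u i := by
    intro i
    by_cases hi : j < d i
    · refine ⟨0, isHomogeneous_zero _ _ _, fun _ => rfl, ?_⟩
      rw [map_zero]
      ext k
      rw [hu i k (by omega), Polynomial.coeff_zero]
    · obtain ⟨q, hq, hq'⟩ := exists_homogenization_univariate (u i) (n := j - d i)
        (Polynomial.natDegree_le_iff_coeff_eq_zero.2 fun k hk => hu i k (by omega))
      exact ⟨q, hq, fun h => absurd h hi, hq' σ τ⟩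
  choose G h1 h2 h3 using h
  exact ⟨G, h1, h2, h3⟩

theorem isHomogeneous_dotProduct {K : Type*} [CommRing K] {d : Fin 3 → ℕ} {j : ℕ}
    {f G : Fin 3 → MvPolynomial (Fin 3) K} (hf : ∀ i, (f i).IsHomogeneous (d i))
    (hG : ∀ i, (G i).IsHomogeneous (j - d i)) (hG0 : ∀ i, j < d i → G i = 0) :
    (G ⬝ᵥ f).IsHomogeneous j := by
  refine IsHomogeneous.sum _ _ _ fun i _ => ?_
  by_cases hi : j < d i
  · rw [hG0 i hi, zero_mul]
    exact isHomogeneous_zero _ _ _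
  · have := (hG i).mul (hf i)
    rwa [show j - d i + d i = j by omega] at this

theorem dotProduct_mem_span {K : Type*} [CommRing K] (f G : Fin 3 → MvPolynomial (Fin 3) K) :
    G ⬝ᵥ f ∈ Ideal.span (Set.range f) :=
  Ideal.mem_span_range_iff_exists_fun.2 ⟨G, rfl⟩

theorem isHomogeneous_line {K : Type*} [CommRing K] (σ τ : K) :
    (X 2 - C σ * X 0 - C τ * X 1 : MvPolynomial (Fin 3) K).IsHomogeneous 1 :=
  ((isHomogeneous_X _ _).sub (isHomogeneous_C_mul_X _ _)).sub (isHomogeneous_C_mul_X _ _)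

theorem line_ne_zero {K : Type*} [CommRing K] [Nontrivial K] (σ τ : K) :
    (X 2 - C σ * X 0 - C τ * X 1 : MvPolynomial (Fin 3) K) ≠ 0 := by
  intro h
  have := congrArg (eval ![0, 0, 1]) h
  simp at this

section point
variable {K : Type*} [Field K] {f : Fin 3 → MvPolynomial (Fin 3) K} {d : Fin 3 → ℕ}

/-- If the restrictions of the generators to a line generate in degree `m + 1`, then multiplication
by the equation of the line is surjective onto degree `m + 1`. -/
theorem lefSurj_of_generatesDegLT (hf : ∀ i, (f i).IsHomogeneous (d i)) {m : ℕ} {σ τ : K}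
    (h : GeneratesDegLT d (fun i => lineRestrict K σ τ (f i)) (m + 2)) :
    LefSurj (Ideal.span (Set.range f)) (X 2 - C σ * X 0 - C τ * X 1) m := by
  intro g hg
  obtain ⟨u, hu, huf⟩ := h (lineRestrict K σ τ g) (Polynomial.mem_degreeLT.2
    (lt_of_le_of_lt (Polynomial.degree_le_of_natDegree_le (lineRestrict_natDegree_le σ τ hg))
      (by exact_mod_cast Nat.lt_succ_self (m + 1))))
  obtain ⟨G, hG, hG0, hGu⟩ := exists_isHomogeneous_lift hu σ τ
  have h1 : (g - G ⬝ᵥ f).IsHomogeneous (m + 1) := hg.sub (isHomogeneous_dotProduct hf hG hG0)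
  obtain ⟨w, hw⟩ := dvd_of_lineRestrict_eq_zero σ τ h1 (by
    rw [map_sub, ← huf]
    simp only [dotProduct, map_sum, map_mul, hGu, sub_self])
  refine ⟨homogeneousComponent m w, homogeneousComponent_isHomogeneous _ _, ?_⟩
  have h2 := congrArg (homogeneousComponent (1 + m)) hw
  rw [homogeneousComponent_mul_left (isHomogeneous_line σ τ), add_comm 1 m,
    homogeneousComponent_of_mem h1, if_pos rfl] at h2
  rw [← h2, sub_sub_cancel]
  exact dotProduct_mem_span f G

/-- If all syzygies of the restrictions to a line lift, then multiplication by the equation of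
the line is injective. -/
theorem lefInj_of_lift (hf : ∀ i, (f i).IsHomogeneous (d i)) {m : ℕ} {σ τ : K}
    (hlift : ∀ u, ShiftedDegLT d (m + 2) u → (u ⬝ᵥ fun i => lineRestrict K σ τ (f i)) = 0 →
      ∃ G : Fin 3 → MvPolynomial (Fin 3) K, (∀ i, (G i).IsHomogeneous (m + 1 - d i)) ∧
        G ⬝ᵥ f = 0 ∧ ∀ i, lineRestrict K σ τ (G i) = u i) :
    LefInj (Ideal.span (Set.range f)) (X 2 - C σ * X 0 - C τ * X 1) m := by
  intro h hh hmem
  have hl := (isHomogeneous_line σ τ).mul hh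
  rw [add_comm] at hl
  obtain ⟨g, hg, hg0, hgf⟩ := exists_homogeneous_combination hf hl hmem
  have hline : lineRestrict K σ τ (X 2 - C σ * X 0 - C τ * X 1) = 0 := by
    simp [lineRestrict, Polynomial.C_eq_algebraMap]
  obtain ⟨G, hG, hGf, hGu⟩ := hlift _ (shiftedDegLT_lineRestrict hg hg0 σ τ) (by
    have := congrArg (lineRestrict K σ τ) hgf
    rw [map_mul, hline, zero_mul, dotProduct, map_sum] at this
    simpa only [map_mul, dotProduct] using this)
  have h1 : ∀ i, X 2 - C σ * X 0 - C τ * X 1 ∣ g i - G i := fun i =>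
    dvd_of_lineRestrict_eq_zero σ τ ((hg i).sub (hG i)) (by rw [map_sub, hGu, sub_self])
  choose q hq using h1
  have h2 : h = q ⬝ᵥ f := by
    refine mul_left_cancel₀ (line_ne_zero σ τ) ?_
    rw [← hgf, ← sub_zero (g ⬝ᵥ f), ← hGf]
    simp only [dotProduct, ← Finset.sum_sub_distrib, Finset.mul_sum]
    refine Finset.sum_congr rfl fun i _ => ?_
    rw [← sub_mul, hq i, mul_assoc]
  rw [h2]
  exact dotProduct_mem_span f q

/-- If a homogeneous syzygy restricts to a syzygy of minimal degree on a line, then all syzygies of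
small degree on this line lift. -/
theorem exists_lift_of_minimal_syzygy (hf : ∀ i, (f i).IsHomogeneous (d i)) {σ τ : K}
    {r : Fin 3 → K[X]} (hr : (r ⬝ᵥ fun i => lineRestrict K σ τ (f i)) = 1)
    (htop : ∃ i, (lineRestrict K σ τ (f i)).coeff (d i) ≠ 0) {a j : ℕ} (haj : a ≤ j)
    (hn : ¬ GeneratesDegLT d (fun i => lineRestrict K σ τ (f i)) (j + 1))
    (hmin : ∀ u, ShiftedDegLT d a u → (u ⬝ᵥ fun i => lineRestrict K σ τ (f i)) = 0 → u = 0)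
    {U : Fin 3 → MvPolynomial (Fin 3) K} (hU : ∀ i, (U i).IsHomogeneous (a - d i))
    (hU0 : ∀ i, a < d i → U i = 0) (hUf : U ⬝ᵥ f = 0)
    (hUp : ∃ i, lineRestrict K σ τ (U i) ≠ 0)
    {u : Fin 3 → K[X]} (hu : ShiftedDegLT d (j + 1) u)
    (huf : (u ⬝ᵥ fun i => lineRestrict K σ τ (f i)) = 0) :
    ∃ G : Fin 3 → MvPolynomial (Fin 3) K, (∀ i, (G i).IsHomogeneous (j - d i)) ∧
      G ⬝ᵥ f = 0 ∧ ∀ i, lineRestrict K σ τ (G i) = u i := by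
  have hUd := shiftedDegLT_lineRestrict hU hU0 σ τ
  have hUs : ((fun i => lineRestrict K σ τ (U i)) ⬝ᵥ fun i => lineRestrict K σ τ (f i)) = 0 := by
    have := congrArg (lineRestrict K σ τ) hUf
    rw [map_zero, dotProduct, map_sum] at this
    simpa only [map_mul, dotProduct] using this
  have hUne : (fun i => lineRestrict K σ τ (U i)) ≠ 0 := by
    obtain ⟨i, hi⟩ := hUp
    exact fun h => hi (congrFun h i)
  obtain ⟨e, v, q, he, hev, hqv⟩ := exists_smul_unimodular hUne
  have hUi : ∀ i, lineRestrict K σ τ (U i) = e * v i := fun i => congrFun hev i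
  rw [hev] at hUd hUs hUne
  have hvd := hUd.of_smul he
  rw [smul_dotProduct, smul_eq_mul] at hUs
  have hvs := (mul_eq_zero.1 hUs).resolve_left he
  have hv0 : v ≠ 0 := by
    rintro rfl
    simp at hqv
  obtain ⟨a', ha', hva', i, k, hik, hvk⟩ := exists_shiftedDeg_eq hv0 hvd
  obtain rfl : a' = a := by
    by_contra hne
    exact hv0 (hmin v (hva'.mono (by omega)) hvs)
  have hec : ∀ k', 1 ≤ k' → e.coeff k' = 0 := fun k' hk' =>
    coeff_eq_zero_of_mul_shifted (m := k + 1) hvk (fun l hl => hUd i l (by omega)) k' (by omega)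
  have hCe : e = Polynomial.C (e.coeff 0) := by
    ext k'
    rcases k' with _ | k'
    · simp
    · rw [hec _ (by omega), Polynomial.coeff_C_succ]
  have hc : e.coeff 0 ≠ 0 := by
    intro h
    rw [h, Polynomial.C_0] at hCe
    exact he hCe
  have hcross := crossProduct_syzygies_eq_zero hr (fun i => lineRestrict_natDegree_le σ τ (hf i))
    htop hn (hvd.mono (by omega)) (hu.mono (by omega)) hvs huf
  have huw := eq_smul_of_crossProduct_eq_zero hqv hcross
  set w := q ⬝ᵥ u with hw
  have hwd : (Polynomial.C (e.coeff 0)⁻¹ * w).natDegree ≤ j - a' := by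
    refine (Polynomial.natDegree_C_mul_le _ _).trans ?_
    refine Polynomial.natDegree_le_iff_coeff_eq_zero.2 fun l hl => ?_
    refine coeff_eq_zero_of_mul_shifted (m := j + 1 - d i) hvk (fun l hl => ?_) l (by omega)
    have := hu i l (by omega)
    rwa [huw] at this
  obtain ⟨ρ, hρ, hρ'⟩ := exists_homogenization_univariate _ hwd
  refine ⟨fun i => ρ * U i, fun i => ?_, ?_, fun i => ?_⟩
  · change (ρ * U i).IsHomogeneous (j - d i)
    by_cases hi : a' < d i
    · rw [hU0 i hi, mul_zero]
      exact isHomogeneous_zero _ _ _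
    · have := hρ.mul (hU i)
      rwa [show j - a' + (a' - d i) = j - d i by omega] at this
  · rw [show (fun i => ρ * U i) = ρ • U from rfl, smul_dotProduct, hUf, smul_zero]
  · rw [map_mul, hρ', hUi, huw, hCe, Polynomial.coeff_C_zero]
    simp only [Pi.smul_apply, smul_eq_mul]
    have : Polynomial.C (e.coeff 0)⁻¹ * Polynomial.C (e.coeff 0) = 1 := by
      rw [← Polynomial.C_mul, inv_mul_cancel₀ hc, Polynomial.C_1]
    linear_combination (w * v i) * this

end point

/-- For each degree `m`, the equation of a generic line satisfies the weak Lefschetz condition. -/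
theorem exists_generic_lefInj_or_lefSurj {K : Type*} [Field K] [CharZero K]
    {f : Fin 3 → MvPolynomial (Fin 3) K} {d : Fin 3 → ℕ} (hf : ∀ i, (f i).IsHomogeneous (d i))
    {N : ℕ} (hN : ∀ i, (X i : MvPolynomial (Fin 3) K) ^ N ∈ Ideal.span (Set.range f)) (m : ℕ) :
    ∃ δ : K[X][X], δ ≠ 0 ∧ ∀ φ : K[X][X] →ₐ[K] K, φ δ ≠ 0 →
      LefInj (Ideal.span (Set.range f))
        (X 2 - C (φ (Polynomial.C Polynomial.X)) * X 0 - C (φ Polynomial.X) * X 1) m ∨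
      LefSurj (Ideal.span (Set.range f))
        (X 2 - C (φ (Polynomial.C Polynomial.X)) * X 0 - C (φ Polynomial.X) * X 1) m := by
  classical
  let F := FractionRing K[X][X]
  have hinj : Function.Injective (algebraMap K[X][X] F) := IsFractionRing.injective _ _
  set g : Fin 3 → K[X][X][X] := fun i =>
    lineRestrict K (Polynomial.C Polynomial.X : K[X][X]) Polynomial.X (f i) with hg
  have hgdeg : ∀ i, (g i).natDegree ≤ d i := fun i => lineRestrict_natDegree_le _ _ (hf i)
  have hmap : ∀ (φ : K[X][X] →ₐ[K] K) i, (g i).map (φ : K[X][X] →+* K) =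
      lineRestrict K (φ (Polynomial.C Polynomial.X)) (φ Polynomial.X) (f i) :=
    fun φ i => lineRestrict_map φ _ _ _
  by_cases hgen : GeneratesDegLT d (fun i => (g i).map (algebraMap K[X][X] F)) (m + 2)
  · obtain ⟨δ, hδ, h⟩ := exists_specialization_of_generates hgdeg hgen K
    refine ⟨δ, hδ, fun φ hφ => Or.inr (lefSurj_of_generatesDegLT hf ?_)⟩
    have := h φ hφ
    simpa only [hmap] using this
  by_cases hsyz : ∀ u, ShiftedDegLT d (m + 2) u → u ⬝ᵥ g = 0 → u = 0
  · obtain ⟨δ, hδ, h⟩ := exists_specialization_of_no_syzygy hgdeg hsyz K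
    refine ⟨δ, hδ, fun φ hφ => Or.inl (lefInj_of_lift hf fun u hu huf => ?_)⟩
    have := h φ hφ u hu (by simpa only [AlgHom.coe_toRingHom, hmap] using huf)
    subst this
    exact ⟨0, fun i => isHomogeneous_zero _ _ _, zero_dotProduct _, fun i => by simp⟩
  have hex : ∃ b, ∃ u, ShiftedDegLT d b u ∧ u ⬝ᵥ g = 0 ∧ u ≠ 0 := by
    push Not at hsyz
    exact ⟨_, hsyz⟩
  obtain ⟨u₀, hu₀, hu₀g, hu₀ne⟩ := Nat.find_spec hex
  have hble : Nat.find hex ≤ m + 2 := by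
    push Not at hsyz
    exact Nat.find_min' hex hsyz
  have hbmin : ∀ b, b < Nat.find hex → ∀ u, ShiftedDegLT d b u → u ⬝ᵥ g = 0 → u = 0 := by
    intro b hb u hu hug
    by_contra hne
    exact Nat.find_min hex hb ⟨u, hu, hug, hne⟩
  obtain ⟨a, ha⟩ : ∃ a, Nat.find hex = a + 1 := by
    refine Nat.exists_eq_succ_of_ne_zero fun h0 => hu₀ne ?_
    rw [h0] at hu₀
    ext i k
    simp [hu₀ i k (Nat.zero_le _)]
  rw [ha] at hu₀ hble hbmin
  have hrank : ∀ u v : Fin 3 → K[X][X][X], ShiftedDegLT d (a + 2) u → ShiftedDegLT d (a + 2) v →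
      u ⬝ᵥ g = 0 → v ⬝ᵥ g = 0 → crossProduct u v = 0 := by
    intro u v hu hv hug hvg
    obtain ⟨r, hr⟩ := exists_dotProduct_lineRestrict_eq_one (hN 1)
      (Polynomial.C Polynomial.X : K[X][X]) Polynomial.X
    have hdot : ∀ u v : Fin 3 → K[X][X][X],
        ((fun i => (u i).map (algebraMap K[X][X] F)) ⬝ᵥ
          fun i => (v i).map (algebraMap K[X][X] F)) = (u ⬝ᵥ v).map (algebraMap K[X][X] F) := by
      intro u v
      simp only [dotProduct, Polynomial.map_sum, Polynomial.map_mul]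
    have hdeg' : ∀ u, ShiftedDegLT d (a + 2) u →
        ShiftedDegLT d (m + 2 + 1) fun i => (u i).map (algebraMap K[X][X] F) := by
      intro u hu i k hk
      rw [Polynomial.coeff_map, hu i k (by omega), map_zero]
    have key := crossProduct_syzygies_eq_zero
      (f := fun i => (g i).map (algebraMap K[X][X] F)) (d := d)
      (r := fun i => (r i).map (algebraMap K[X][X] F))
      (by rw [hdot, hr, Polynomial.map_one])
      (fun i => Polynomial.natDegree_map_le.trans (hgdeg i))
      (by
        obtain ⟨i, hi⟩ := exists_coeff_lineRestrict_ne_zero hf (hN 0)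
          (Polynomial.C Polynomial.X : K[X][X]) Polynomial.X
        refine ⟨i, ?_⟩
        rw [Polynomial.coeff_map]
        exact (map_ne_zero_iff _ hinj).2 hi)
      hgen (hdeg' u hu) (hdeg' v hv) (by rw [hdot, hug, Polynomial.map_zero])
      (by rw [hdot, hvg, Polynomial.map_zero])
    rw [crossProduct_eq_zero_iff_mul] at key ⊢
    intro i k
    refine Polynomial.map_injective _ hinj ?_
    rw [Polynomial.map_mul, Polynomial.map_mul]
    exact key i k
  obtain ⟨U, hU, hU0, hUf, i, hi⟩ :=
    exists_homogeneous_syzygy hf hu₀ne hu₀ (fun i => rfl) hu₀g hrank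
  obtain ⟨k, hk⟩ : ∃ k, (lineRestrict K (Polynomial.C Polynomial.X : K[X][X]) Polynomial.X
      (U i)).coeff k ≠ 0 := by
    by_contra! h
    exact hi (Polynomial.ext fun k => by rw [h, Polynomial.coeff_zero])
  obtain ⟨δ, hδ, h⟩ := exists_specialization_of_no_syzygy hgdeg (hbmin a (Nat.lt_succ_self a)) K
  refine ⟨δ * _, mul_ne_zero hδ hk, fun φ hφ => ?_⟩
  rw [map_mul] at hφ
  by_cases hgen' : GeneratesDegLT d (fun i => lineRestrict K (φ (Polynomial.C Polynomial.X))
      (φ Polynomial.X) (f i)) (m + 2)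
  · exact Or.inr (lefSurj_of_generatesDegLT hf hgen')
  refine Or.inl (lefInj_of_lift hf fun u hu huf => ?_)
  obtain ⟨r, hr⟩ := exists_dotProduct_lineRestrict_eq_one (hN 1)
    (φ (Polynomial.C Polynomial.X)) (φ Polynomial.X)
  refine exists_lift_of_minimal_syzygy hf hr (exists_coeff_lineRestrict_ne_zero hf (hN 0) _ _)
    (a := a) (j := m + 1) (by omega) hgen' (fun u hu huf => ?_) hU hU0 hUf ⟨i, fun hz => ?_⟩ hu huf
  · exact h φ (left_ne_zero_of_mul hφ) u hu (by simpa only [AlgHom.coe_toRingHom, hmap] using huf)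
  · refine right_ne_zero_of_mul hφ ?_
    have h1 := congrArg (fun p => Polynomial.coeff p k) (lineRestrict_map φ
      (Polynomial.C Polynomial.X : K[X][X]) Polynomial.X (U i))
    simp only [hz, Polynomial.coeff_map, Polynomial.coeff_zero] at h1
    exact h1

/-- A nonzero polynomial in two variables does not vanish at some point. -/
theorem exists_algHom_ne_zero {K : Type*} [Field K] [Infinite K] {δ : K[X][X]} (hδ : δ ≠ 0) :
    ∃ φ : K[X][X] →ₐ[K] K, φ δ ≠ 0 := by
  obtain ⟨t, ht⟩ : ∃ t : K, δ.eval (Polynomial.C t) ≠ 0 := by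
    by_contra! h
    refine hδ (Polynomial.eq_zero_of_infinite_isRoot δ ?_)
    refine Set.Infinite.mono ?_ (Set.infinite_range_of_injective
      (Polynomial.C_injective (R := K)))
    rintro _ ⟨t, rfl⟩
    exact h t
  obtain ⟨s, hs⟩ : ∃ s : K, (δ.eval (Polynomial.C t)).eval s ≠ 0 := by
    by_contra! h
    exact ht (Polynomial.funext fun s => by rw [h, Polynomial.eval_zero])
  refine ⟨(Polynomial.aeval s).comp
    ((Polynomial.aeval (R := K[X]) (Polynomial.C t : K[X])).restrictScalars K), ?_⟩
  simpa [Polynomial.aeval_def, Polynomial.eval₂_eq_eval_map] using hs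

end LineRestriction

/-- **`A(3) ≥ 3`**: over an algebraically closed field of characteristic zero, every
homogeneous `R₊`-primary ideal `I ⊆ K[X,Y,Z]` generated by at most three homogeneous
polynomials has the Weak Lefschetz property. -/
theorem three_generated_artinian_weakLefschetz
    {K : Type*} [Field K] [IsAlgClosed K] [CharZero K]
    (I : Ideal (MvPolynomial (Fin 3) K))
    (f : Fin 3 → MvPolynomial (Fin 3) K) (d : Fin 3 → ℕ)
    (hf : ∀ i, (f i).IsHomogeneous (d i))
    (hgen : I = Ideal.span (Set.range f))
    (hprimary : I.radical = Ideal.span {X 0, X 1, X 2}) :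
    WeakLefschetz I := by
  subst hgen
  have hrad : ∀ i, (X i : MvPolynomial (Fin 3) K) ∈ (Ideal.span (Set.range f)).radical := by
    intro i
    rw [hprimary]
    refine Ideal.subset_span ?_
    fin_cases i <;> simp
  choose e he using hrad
  have hN : ∀ i, (X i : MvPolynomial (Fin 3) K) ^ (e 0 + e 1 + e 2) ∈
      Ideal.span (Set.range f) := by
    intro i
    refine Ideal.pow_mem_of_pow_mem _ (he i) ?_
    fin_cases i <;> simp only [Fin.reduceFinMk, Fin.zero_eta, Fin.mk_one] <;> omega
  set N := e 0 + e 1 + e 2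
  choose δ hδ h using exists_generic_lefInj_or_lefSurj hf hN
  obtain ⟨φ, hφ⟩ := exists_algHom_ne_zero (δ := ∏ m ∈ Finset.range (3 * N), δ m)
    (Finset.prod_ne_zero_iff.2 fun m _ => hδ m)
  rw [map_prod, Finset.prod_ne_zero_iff] at hφ
  refine ⟨_, line_ne_zero (φ (Polynomial.C Polynomial.X)) (φ Polynomial.X),
    isHomogeneous_line _ _, fun m => ?_⟩
  by_cases hm : m < 3 * N
  · exact h m φ (hφ m (Finset.mem_range.2 hm))
  · refine Or.inr fun g hg => ⟨0, isHomogeneous_zero _ _ _, ?_⟩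
    rw [mul_zero, sub_zero, g.as_sum]
    refine Ideal.sum_mem _ fun x hx => ?_
    have hx' := hg.apply_add hx
    obtain ⟨i, hi⟩ : ∃ i, N ≤ x i := by
      by_contra! hlt
      have h0 := hlt 0
      have h1 := hlt 1
      have h2 := hlt 2
      omega
    have hdvd : (X i : MvPolynomial (Fin 3) K) ^ N ∣ monomial x (coeff x g) := by
      rw [X_pow_eq_monomial, monomial_dvd_monomial]
      exact ⟨Or.inr (Finsupp.single_le_iff.2 hi), one_dvd _⟩
    exact Ideal.mem_of_dvd _ hdvd (hN i)
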